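/- arXiv:1504.04424 — 5 statements merged into one kernel-verified Lean document; each statement's English description precedes it below -/
import Mathlib

section
/- Let V be a doubled word with k distinct letters, let Σ be a finite alphabet with q ≥ 2 letters, and let W_n ∈ Σ^n be chosen uniformly at random. Then the series c = Σ_{j=k}^{∞} C(j+1, k+1) q^{-j} converges, and for all n ≥ |V|, E(δ(V,W_n)) ≤ c·(n − |V| + 1)/C(n+1, 2); in particular E(δ(V,W_n)) = O(1/n). -/
open Filter Asymptotics

/-- The substring `W[i,j]` of `W`: the `j - i` consecutive letters of `W`
beginning with the `(i+1)`-th. -/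
def subword {β : Type*} (W : List β) (i j : ℕ) : List β :=
  (W.drop i).take (j - i)

/-- `W` is an instance of `V` provided `W = φ(V)` for some nonerasing
homomorphism `φ`, i.e. a map on letters (no letter mapping to the empty word)
extended by concatenation. -/
def IsInstance {α β : Type*} (V : List α) (W : List β) : Prop :=
  ∃ φ : α → List β, (∀ a, φ a ≠ []) ∧ W = (V.map φ).flatten

/-- A word is doubled provided every letter occurring in it occurs at least twice. -/
def Doubled {α : Type*} [DecidableEq α] (V : List α) : Prop :=
  ∀ a ∈ V, 2 ≤ V.count a

open Classical in
/-- `density V W` is the proportion of the `C(|W|+1, 2)` substrings of `W`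
(indexed by pairs `(i,j)` with `0 ≤ i < j ≤ |W|`) that are instances of `V`. -/
noncomputable def density {α β : Type*} (V : List α) (W : List β) : ℝ :=
  (((Finset.range (W.length + 1) ×ˢ Finset.range (W.length + 1)).filter
      (fun p => p.1 < p.2 ∧ IsInstance V (subword W p.1 p.2))).card : ℝ) /
    (Nat.choose (W.length + 1) 2)

/-- The expected density of `V` in a word of length `n` chosen uniformly at
random over the alphabet `σ` (words of length `n` being encoded as `Fin n → σ`). -/
noncomputable def expDensity {α : Type*} (V : List α) (σ : Type*) [Fintype σ] (n : ℕ) : ℝ :=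
  (∑ w : Fin n → σ, density V (List.ofFn w)) / (Fintype.card σ : ℝ) ^ n

/-- `homCount V W` counts the encounters of `V` in `W`: triples `(a, b, φ)`
where `φ` is a nonerasing homomorphism from the letters of `V` with
`W[a,b] = φ(V)`. -/
noncomputable def homCount {α σ : Type*} (V : List α) (W : List σ) : ℕ :=
  Set.ncard {t : ℕ × ℕ × ({a : α // a ∈ V} → List σ) |
    t.1 < t.2.1 ∧ t.2.1 ≤ W.length ∧ (∀ a, t.2.2 a ≠ []) ∧
    subword W t.1 t.2.1 = (V.attach.map t.2.2).flatten}

/-- Expected number of encounters of `V` in a uniformly random word of length `n`. -/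
noncomputable def expHom {α : Type*} (V : List α) (σ : Type*) [Fintype σ] (n : ℕ) : ℝ :=
  (∑ w : Fin n → σ, (homCount V (List.ofFn w) : ℝ)) / (Fintype.card σ : ℝ) ^ n

/-- `instProb V σ m` is the proportion of words in `σ^m` that are instances of `V`. -/
noncomputable def instProb {α : Type*} (V : List α) (σ : Type*) [Fintype σ] (m : ℕ) : ℝ :=
  (Nat.card {w : Fin m → σ // IsInstance V (List.ofFn w)} : ℝ) / (Fintype.card σ : ℝ) ^ m

/-- The variance of the density of `V` in a uniformly random word of length `n`. -/
noncomputable def varDensity {α : Type*} (V : List α) (σ : Type*) [Fintype σ] (n : ℕ) : ℝ :=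
  (∑ w : Fin n → σ, (density V (List.ofFn w) - expDensity V σ n) ^ 2) /
    (Fintype.card σ : ℝ) ^ n

/-- total length of the image of `V` under a homomorphism with letter lengths `r`. -/
def imgLen {α : Type*} [DecidableEq α] (V : List α) (r : {a // a ∈ V.toFinset} → ℕ) : ℕ :=
  ∑ a, V.count a.1 * r a

/-- `U` is an image of `V` under a homomorphism with letter lengths `r`. -/
def InstLen {α σ : Type*} [DecidableEq α] (V : List α) (r : {a // a ∈ V.toFinset} → ℕ)
    (U : List σ) : Prop :=
  ∃ φ : α → List σ, (∀ a : {a // a ∈ V.toFinset}, (φ a.1).length = r a) ∧ U = (V.map φ).flatten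

lemma flatten_len {α σ : Type*} [DecidableEq α] (V : List α) (φ : α → List σ) :
    ((V.map φ).flatten).length = imgLen V (fun a => (φ a.1).length) := by
  rw [List.length_flatten, List.map_map, Finset.sum_list_map_count, imgLen,
    ← Finset.sum_coe_sort V.toFinset]
  simp

lemma exists_instLen {α σ : Type*} [DecidableEq α] (V : List α) (U : List σ) (n : ℕ)
    (hn : U.length ≤ n) (h : IsInstance V U) :
    ∃ r ∈ Fintype.piFinset (fun _ : {a // a ∈ V.toFinset} => Finset.Icc 1 n),
      U.length = imgLen V r ∧ InstLen V r U := by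
  obtain ⟨φ, h0, rfl⟩ := h
  refine ⟨fun a => (φ a.1).length, ?_, flatten_len V φ, φ, fun _ => rfl, rfl⟩
  rw [Fintype.mem_piFinset]
  intro a
  rw [Finset.mem_Icc]
  refine ⟨List.length_pos_iff.2 (h0 _), le_trans ?_ hn⟩
  rw [flatten_len, imgLen]
  have h1 : 1 ≤ V.count a.1 := List.count_pos_iff.2 (List.mem_toFinset.1 a.2)
  calc (φ a.1).length ≤ V.count a.1 * (φ a.1).length := Nat.le_mul_of_pos_left _ h1
    _ ≤ _ := Finset.single_le_sum
      (f := fun a : {a // a ∈ V.toFinset} => V.count a.1 * (φ a.1).length)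
      (fun _ _ => Nat.zero_le _) (Finset.mem_univ a)

open Classical in
lemma card_instLen {α σ : Type*} [DecidableEq α] [Fintype σ] (V : List α)
    (r : {a // a ∈ V.toFinset} → ℕ) (n i j : ℕ) (hij : i ≤ j) (hj : j ≤ n) :
    (Finset.univ.filter
      (fun w : Fin n → σ => InstLen V r (subword (List.ofFn w) i j))).card
      ≤ Fintype.card σ ^ i * Fintype.card σ ^ (∑ a, r a) * Fintype.card σ ^ (n - j) := by
  let F : (Fin i → σ) × ((a : {a // a ∈ V.toFinset}) → (Fin (r a) → σ)) × (Fin (n - j) → σ)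
      → List σ := fun t => List.ofFn t.1 ++ ((V.map (fun a =>
        if h : a ∈ V.toFinset then List.ofFn (t.2.1 ⟨a, h⟩) else [])).flatten ++ List.ofFn t.2.2)
  have hsub : (Finset.univ.filter
      (fun w : Fin n → σ => InstLen V r (subword (List.ofFn w) i j))).image List.ofFn
      ⊆ Finset.univ.image F := by
    intro l hl
    obtain ⟨w, hw, rfl⟩ := Finset.mem_image.1 hl
    obtain ⟨φ, hφ, hU⟩ := (Finset.mem_filter.1 hw).2
    refine Finset.mem_image.2 ⟨⟨fun t => w ⟨t, by omega⟩,
      fun a t => (φ a.1)[t.1]'(by rw [hφ]; exact t.2), fun t => w ⟨j + t, by omega⟩⟩,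
      Finset.mem_univ _, ?_⟩
    have e1 : List.ofFn (fun t : Fin i => w ⟨t, by omega⟩) = (List.ofFn w).take i := by
      apply List.ext_getElem
      · simp; omega
      · intros; simp
    have e2 : List.ofFn (fun t : Fin (n - j) => w ⟨j + t, by omega⟩) = (List.ofFn w).drop j := by
      apply List.ext_getElem
      · simp
      · intros; simp
    have e3 : (V.map (fun a =>
        if h : a ∈ V.toFinset then
          List.ofFn (fun t : Fin (r ⟨a, h⟩) => (φ a)[t.1]'(by
            rw [hφ ⟨a, h⟩]; exact t.2)) else [])) = V.map φ := by
      apply List.map_congr_left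
      intro a ha
      rw [dif_pos (List.mem_toFinset.2 ha)]
      apply List.ext_getElem
      · simp [hφ ⟨a, List.mem_toFinset.2 ha⟩]
      · intros; simp
    change List.ofFn _ ++ ((V.map _).flatten ++ List.ofFn _) = _
    rw [e1, e2]
    refine (congrArg (fun z => _ ++ (List.flatten z ++ _)) e3).trans ?_
    rw [← hU, subword]
    have : (List.ofFn w).drop j = ((List.ofFn w).drop i).drop (j - i) := by
      rw [List.drop_drop]; congr 1; omega
    rw [this, List.take_append_drop, List.take_append_drop]
  have h1 := Finset.card_le_card hsub
  rw [Finset.card_image_of_injective _ List.ofFn_injective] at h1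
  refine h1.trans (Finset.card_image_le.trans ?_)
  simp [Finset.card_univ, Fintype.card_pi, Finset.prod_pow_eq_pow_sum, mul_assoc]

lemma two_mul_le_imgLen {α : Type*} [DecidableEq α] (V : List α) (hV : Doubled V)
    (r : {a // a ∈ V.toFinset} → ℕ) : 2 * ∑ a, r a ≤ imgLen V r := by
  rw [imgLen, Finset.mul_sum]
  exact Finset.sum_le_sum fun a _ => Nat.mul_le_mul_right _ (hV _ (List.mem_toFinset.1 a.2))

lemma length_le_imgLen {α : Type*} [DecidableEq α] (V : List α)
    (r : {a // a ∈ V.toFinset} → ℕ) (hr : ∀ a, 1 ≤ r a) : V.length ≤ imgLen V r := by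
  have h := flatten_len V (fun _ => [()])
  have h2 : ((V.map (fun _ => [()])).flatten).length = V.length := by simp
  rw [← h2, h, imgLen, imgLen]
  exact Finset.sum_le_sum fun a _ => Nat.mul_le_mul_left _ (by simpa using hr a)

lemma card_pairs (n L v : ℕ) (h : v ≤ L) :
    ((Finset.range (n + 1) ×ˢ Finset.range (n + 1)).filter
      (fun p => p.1 < p.2 ∧ p.2 - p.1 = L)).card ≤ n + 1 - v := by
  have : ((Finset.range (n + 1) ×ˢ Finset.range (n + 1)).filter
      (fun p => p.1 < p.2 ∧ p.2 - p.1 = L)).card ≤ (Finset.range (n + 1 - v)).card := by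
    apply Finset.card_le_card_of_injOn Prod.fst
    · intro p hp
      simp at hp ⊢
      omega
    · intro p hp p' hp' e
      simp at hp hp'
      ext
      · exact e
      · omega
  simpa using this

open Classical in
lemma expCount_le {α σ : Type*} [DecidableEq α] [Fintype σ] (V : List α)
    (hV : Doubled V) (hq : 2 ≤ Fintype.card σ) (n : ℕ) :
    (∑ w : Fin n → σ, (((Finset.range (n + 1) ×ˢ Finset.range (n + 1)).filter
      (fun p => p.1 < p.2 ∧ IsInstance V (subword (List.ofFn w) p.1 p.2))).card : ℝ)) ≤
    (Fintype.card σ : ℝ) ^ n * (((n + 1 - V.length : ℕ) : ℝ) *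
      (∑ m ∈ Finset.Icc 1 n, ((Fintype.card σ : ℝ))⁻¹ ^ m) ^ V.toFinset.card) := by
  set q := Fintype.card σ with hqdef
  have hq0 : (0 : ℝ) < q := by exact_mod_cast (by omega : 0 < q)
  set P := Finset.range (n + 1) ×ˢ Finset.range (n + 1) with hP
  set R := Fintype.piFinset (fun _ : {a // a ∈ V.toFinset} => Finset.Icc 1 n) with hR
  have step1 : ∀ w : Fin n → σ,
      ((P.filter
        (fun p => p.1 < p.2 ∧ IsInstance V (subword (List.ofFn w) p.1 p.2))).card : ℝ) ≤
      ∑ r ∈ R, ∑ p ∈ P.filter (fun p => p.1 < p.2 ∧ p.2 - p.1 = imgLen V r),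
        if InstLen V r (subword (List.ofFn w) p.1 p.2) then (1 : ℝ) else 0 := by
    intro w
    have : P.filter (fun p => p.1 < p.2 ∧ IsInstance V (subword (List.ofFn w) p.1 p.2)) ⊆
        R.biUnion (fun r => (P.filter (fun p => p.1 < p.2 ∧ p.2 - p.1 = imgLen V r)).filter
          (fun p => InstLen V r (subword (List.ofFn w) p.1 p.2))) := by
      intro p hp
      obtain ⟨hpP, hlt, hI⟩ := Finset.mem_filter.1 hp
      have hp2 : p.2 ≤ n := by simp [hP] at hpP; omega
      have hl : (subword (List.ofFn w) p.1 p.2).length = p.2 - p.1 := by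
        simp [subword]; omega
      obtain ⟨r, hr, hL, hI'⟩ := exists_instLen V _ n (by omega) hI
      refine Finset.mem_biUnion.2 ⟨r, hr, ?_⟩
      simp only [Finset.mem_filter]
      exact ⟨⟨hpP, hlt, by omega⟩, hI'⟩
    have h2 := (Finset.card_le_card this).trans Finset.card_biUnion_le
    have h3 : ((P.filter
        (fun p => p.1 < p.2 ∧ IsInstance V (subword (List.ofFn w) p.1 p.2))).card : ℝ) ≤ _ :=
      Nat.cast_le.2 h2
    refine h3.trans (le_of_eq ?_)
    push_cast
    refine Finset.sum_congr rfl fun r _ => ?_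
    rw [Finset.sum_boole]
  refine (Finset.sum_le_sum fun w _ => step1 w).trans ?_
  rw [Finset.sum_comm]
  have step2 : ∀ r ∈ R, (∑ w : Fin n → σ,
      ∑ p ∈ P.filter (fun p => p.1 < p.2 ∧ p.2 - p.1 = imgLen V r),
        if InstLen V r (subword (List.ofFn w) p.1 p.2) then (1 : ℝ) else 0) ≤
      (q : ℝ) ^ n * (((n + 1 - V.length : ℕ) : ℝ) * ∏ a, ((q : ℝ))⁻¹ ^ (r a)) := by
    intro r hr
    rw [Finset.sum_comm]
    have hr1 : ∀ a, 1 ≤ r a := fun a => (Finset.mem_Icc.1 (Fintype.mem_piFinset.1 hr a)).1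
    have hb : ∀ p ∈ P.filter (fun p => p.1 < p.2 ∧ p.2 - p.1 = imgLen V r),
        (∑ w : Fin n → σ, if InstLen V r (subword (List.ofFn w) p.1 p.2) then (1 : ℝ) else 0)
        ≤ (q : ℝ) ^ n * ∏ a, ((q : ℝ))⁻¹ ^ (r a) := by
      intro p hp
      obtain ⟨hpP, hlt, hL⟩ := Finset.mem_filter.1 hp
      have hp2 : p.2 ≤ n := by simp [hP] at hpP; omega
      rw [Finset.sum_boole, Finset.prod_pow_eq_pow_sum, inv_pow, ← div_eq_mul_inv,
        le_div_iff₀ (by positivity)]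
      have h2 := two_mul_le_imgLen V hV r
      have hc := card_instLen (σ := σ) V r n p.1 p.2 hlt.le hp2
      have : (Finset.univ.filter
        (fun w : Fin n → σ => InstLen V r (subword (List.ofFn w) p.1 p.2))).card
          * q ^ (∑ a, r a) ≤ q ^ n := by
        refine (Nat.mul_le_mul_right _ hc).trans ?_
        rw [← hqdef, ← pow_add, ← pow_add, ← pow_add]
        exact Nat.pow_le_pow_right (by omega) (by omega)
      exact_mod_cast this
    refine (Finset.sum_le_sum hb).trans ?_
    rw [Finset.sum_const, nsmul_eq_mul, mul_left_comm]
    have hc := card_pairs n (imgLen V r) V.length (length_le_imgLen V r hr1)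
    have hc' : ((P.filter (fun p => p.1 < p.2 ∧ p.2 - p.1 = imgLen V r)).card : ℝ) ≤
      ((n + 1 - V.length : ℕ) : ℝ) := by exact_mod_cast hc
    gcongr
  refine (Finset.sum_le_sum step2).trans (le_of_eq ?_)
  rw [← Finset.mul_sum, ← Finset.mul_sum, hR]
  rw [Finset.sum_prod_piFinset (Finset.Icc 1 n) (fun _ m => ((q : ℝ))⁻¹ ^ m)]
  simp

lemma geom_bound (x : ℝ) (h0 : 0 < x) (h1 : x < 1) (n k : ℕ) :
    Summable (fun j : ℕ => (Nat.choose (j + k + 1) (k + 1) : ℝ) * x ^ (j + k)) ∧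
    (∑ m ∈ Finset.Icc 1 n, x ^ m) ^ k ≤
      ∑' j : ℕ, (Nat.choose (j + k + 1) (k + 1) : ℝ) * x ^ (j + k) := by
  have hs := hasSum_choose_mul_geometric_of_norm_lt_one (k + 1)
    (r := x) (by rw [Real.norm_eq_abs, abs_lt]; constructor <;> linarith)
  have hs' : HasSum (fun j : ℕ => (Nat.choose (j + k + 1) (k + 1) : ℝ) * x ^ (j + k))
      (1 / (1 - x) ^ (k + 1 + 1) * x ^ k) := by
    refine (hs.mul_right (x ^ k)).congr_fun ?_ 
    intro j
    simp [pow_add, mul_assoc, add_assoc]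
  refine ⟨hs'.summable, ?_⟩
  rw [hs'.tsum_eq]
  have hx : 0 < 1 - x := by linarith
  have hg : ∑ m ∈ Finset.Icc 1 n, x ^ m ≤ x / (1 - x) := by
    rw [le_div_iff₀ hx]
    have : ∀ n : ℕ, (∑ m ∈ Finset.Icc 1 n, x ^ m) * (1 - x) = x - x ^ (n + 1) := by
      intro n
      induction n with
      | zero => simp
      | succ n ih => rw [Finset.sum_Icc_succ_top (by omega), add_mul, ih]; ring
    rw [this]
    have : 0 < x ^ (n + 1) := by positivity
    linarith
  calc (∑ m ∈ Finset.Icc 1 n, x ^ m) ^ k ≤ (x / (1 - x)) ^ k := by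
        gcongr
    _ = 1 / (1 - x) ^ k * x ^ k := by rw [div_pow]; ring
    _ ≤ _ := by
        gcongr ?_ * _
        apply one_div_le_one_div_of_le (by positivity)
        exact pow_le_pow_of_le_one hx.le (by linarith) (by omega)

/-- For doubled `V` with `k` distinct letters and `q ≥ 2`, the series
`c = Σ_{j=k}^∞ C(j+1, k+1) q^{-j}` converges, for `n ≥ |V|` we have
`E(δ(V,W_n)) ≤ c (n - |V| + 1) / C(n+1,2)`, and so `E(δ(V,W_n)) = O(1/n)`. -/
theorem stmt1 {α σ : Type*} [DecidableEq α] [Fintype σ] (V : List α)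
    (hV : Doubled V) (k : ℕ) (hk : k = V.toFinset.card)
    (hq : 2 ≤ Fintype.card σ) :
    Summable (fun j : ℕ =>
      (Nat.choose (j + k + 1) (k + 1) : ℝ) * ((Fintype.card σ : ℝ))⁻¹ ^ (j + k)) ∧
    (∀ n : ℕ, V.length ≤ n →
      expDensity V σ n ≤
        (∑' j : ℕ, (Nat.choose (j + k + 1) (k + 1) : ℝ) * ((Fintype.card σ : ℝ))⁻¹ ^ (j + k)) *
          ((n : ℝ) - V.length + 1) / (Nat.choose (n + 1) 2)) ∧
    ∃ C : ℝ, ∀ n : ℕ, 1 ≤ n → expDensity V σ n ≤ C / n := by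
  have hq0 : (0 : ℝ) < Fintype.card σ := by exact_mod_cast (by omega : 0 < Fintype.card σ)
  have hx0 : (0 : ℝ) < ((Fintype.card σ : ℝ))⁻¹ := by positivity
  have hx1 : ((Fintype.card σ : ℝ))⁻¹ < 1 := by
    apply inv_lt_one_of_one_lt₀
    exact_mod_cast (by omega : 1 < Fintype.card σ)
  have hmain : ∀ n : ℕ, expDensity V σ n ≤
      (∑' j : ℕ, (Nat.choose (j + k + 1) (k + 1) : ℝ) * ((Fintype.card σ : ℝ))⁻¹ ^ (j + k)) *
          ((n + 1 - V.length : ℕ) : ℝ) / (Nat.choose (n + 1) 2) := by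
    intro n
    have h1 := expCount_le (σ := σ) V hV hq n
    have h2 := (geom_bound _ hx0 hx1 n k).2
    rw [expDensity]
    simp only [density, List.length_ofFn]
    rw [← Finset.sum_div, div_right_comm]
    gcongr
    rw [div_le_iff₀ (by positivity)]
    refine h1.trans ?_
    rw [← hk, mul_comm]
    rw [mul_comm ((n + 1 - V.length : ℕ) : ℝ)]
    gcongr
  have hc0 : 0 ≤ ∑' j : ℕ,
      (Nat.choose (j + k + 1) (k + 1) : ℝ) * ((Fintype.card σ : ℝ))⁻¹ ^ (j + k) :=
    tsum_nonneg fun j => by positivity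
  refine ⟨(geom_bound _ hx0 hx1 0 k).1, ?_, ?_⟩
  · intro n hn
    have h := hmain n
    rw [Nat.cast_sub (by omega)] at h
    push_cast at h
    rwa [show (n : ℝ) - V.length + 1 = n + 1 - V.length by ring]
  · refine ⟨2 * ∑' j : ℕ,
      (Nat.choose (j + k + 1) (k + 1) : ℝ) * ((Fintype.card σ : ℝ))⁻¹ ^ (j + k), ?_⟩
    intro n hn
    refine (hmain n).trans ?_
    generalize (∑' j : ℕ,
      (Nat.choose (j + k + 1) (k + 1) : ℝ) * ((Fintype.card σ : ℝ))⁻¹ ^ (j + k)) = c at hc0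
    have hn' : (0 : ℝ) < n := by exact_mod_cast hn
    rw [Nat.cast_choose_two]
    push_cast
    have h3 : ((n + 1 - V.length : ℕ) : ℝ) ≤ n + 1 := by
      exact_mod_cast Nat.sub_le _ _
    rw [div_le_div_iff₀ (by rw [add_sub_cancel_right]; positivity) hn']
    have : c * ((n + 1 - V.length : ℕ) : ℝ) * n ≤ c * (n + 1) * n := by gcongr
    linarith
end

section
/- Let V = U_0 x_1 U_1 x_2 ⋯ x_r U_r with r ≥ 1, where U = U_0 U_1 ⋯ U_r is doubled with k distinct letters (any U_j may be empty), the letters x_1, …, x_r are distinct, and no x_i occurs in U. Let Σ be a finite alphabet with q ≥ 2 letters. Then there exists a nondecreasing function g(n) = o(n) such that the proportion of V-instances W ∈ Σ^n admitting a nonerasing homomorphism φ with φ(V) = W and |φ(x_r)| > n − g(n) tends to 1 as n → ∞. -/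
open Filter Asymptotics

section Helpers

/-- Words of length `n` with property `p`. -/
def wset {σ : Type*} (n : ℕ) (p : List σ → Prop) : Set (List σ) := {w | w.length = n ∧ p w}

/-- `w` begins with `φ(P)` and ends with `φ(Q)`. -/
def Bdry {α σ : Type*} (P Q : List α) (w : List σ) : Prop :=
  ∃ φ : α → List σ, (∀ a, φ a ≠ []) ∧ ∃ m, w = (P.map φ).flatten ++ (m ++ (Q.map φ).flatten)

/-- `Bdry` with images of length at most `H`. -/
def BdryH {α σ : Type*} (P Q : List α) (H : ℕ) (w : List σ) : Prop :=
  ∃ φ : α → List σ, (∀ a, φ a ≠ []) ∧ (∀ a, (φ a).length ≤ H) ∧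
    ∃ m, w = (P.map φ).flatten ++ (m ++ (Q.map φ).flatten)

/-- Boundary instances can mostly be shortened. -/
def Short {α : Type*} (σ : Type*) [Fintype σ] (P Q : List α) : Prop :=
  ∀ ε : ℝ, 0 < ε → ∃ H : ℕ, ∀ᶠ n : ℕ in atTop,
    ((wset n (fun w : List σ => Bdry P Q w ∧ ¬ BdryH P Q H w)).ncard : ℝ) ≤
      ε * (Fintype.card σ : ℝ) ^ n

variable {α σ : Type*}

theorem wset_finite [Fintype σ] (n : ℕ) (p : List σ → Prop) : (wset n p).Finite :=
  (List.finite_length_eq σ n).subset (fun _ h => h.1)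

theorem wset_card_eq [Fintype σ] (n : ℕ) (p : List σ → Prop) :
    Nat.card {w : Fin n → σ // p (List.ofFn w)} = (wset n p).ncard := by
  rw [← Nat.card_coe_set_eq]
  refine Nat.card_congr (Equiv.ofBijective
    (fun w => (⟨List.ofFn w.1, by simp [wset, w.2]⟩ : wset n p)) ⟨?_, ?_⟩)
  · rintro ⟨a, ha⟩ ⟨b, hb⟩ h
    exact Subtype.ext (List.ofFn_injective (congrArg Subtype.val h))
  · rintro ⟨w, rfl, hw⟩
    exact ⟨⟨w.get, by simpa using hw⟩, by simp⟩

theorem wset_true [Fintype σ] (n : ℕ) :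
    (wset n (fun _ : List σ => True)).ncard = Fintype.card σ ^ n := by
  rw [← wset_card_eq]
  rw [Nat.card_congr (Equiv.subtypeUnivEquiv (fun _ => trivial))]
  simp

theorem wset_mono [Fintype σ] (n : ℕ) {p q : List σ → Prop}
    (h : ∀ w, w.length = n → p w → q w) : (wset n p).ncard ≤ (wset n q).ncard :=
  Set.ncard_le_ncard (fun w hw => ⟨hw.1, h w hw.1 hw.2⟩) (wset_finite n q)

theorem wset_or [Fintype σ] (n : ℕ) (p q : List σ → Prop) :
    (wset n (fun w => p w ∨ q w)).ncard ≤ (wset n p).ncard + (wset n q).ncard := by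
  refine le_trans (Set.ncard_le_ncard ?_ ((wset_finite n p).union (wset_finite n q)))
    (Set.ncard_union_le _ _)
  rintro w ⟨h1, h2 | h2⟩
  · exact Or.inl ⟨h1, h2⟩
  · exact Or.inr ⟨h1, h2⟩

theorem wset_append [Fintype σ] (a b : ℕ) {p p1 p2 : List σ → Prop}
    (h : ∀ x y, x.length = a → y.length = b → p (x ++ y) → p1 x ∧ p2 y) :
    (wset (a + b) p).ncard ≤ (wset a p1).ncard * (wset b p2).ncard := by
  rw [← Set.ncard_prod]
  have hf : (wset a p1 ×ˢ wset b p2).Finite := (wset_finite a p1).prod (wset_finite b p2)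
  refine le_trans (Set.ncard_le_ncard (t := (fun z : List σ × List σ => z.1 ++ z.2) ''
    (wset a p1 ×ˢ wset b p2)) ?_ (hf.image _)) (Set.ncard_image_le hf)
  rintro w ⟨hl, hw⟩
  have h1 : (w.take a).length = a := by simp [hl]
  have h2 : (w.drop a).length = b := by simp [hl]
  have h3 := h _ _ h1 h2 (by rwa [List.take_append_drop])
  exact ⟨(w.take a, w.drop a), ⟨⟨h1, h3.1⟩, ⟨h2, h3.2⟩⟩, List.take_append_drop _ _⟩

theorem wset_reverse (n : ℕ) (p : List σ → Prop) :
    (wset n (fun w => p w.reverse)).ncard = (wset n p).ncard := by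
  rw [← Set.ncard_image_of_injective (wset n p) List.reverse_injective]
  congr 1
  ext w
  constructor
  · rintro ⟨h1, h2⟩
    exact ⟨w.reverse, ⟨by simpa using h1, h2⟩, by simp⟩
  · rintro ⟨v, ⟨h1, h2⟩, rfl⟩
    exact ⟨by simpa using h1, by simpa using h2⟩

/-- `u` does not occur in `w` at a position in `[s, s+G]`. -/
def NotOcc (s G : ℕ) (u w : List σ) : Prop :=
  ∀ a b, w = a ++ (u ++ b) → s ≤ a.length → s + G < a.length

theorem notOcc_step [Fintype σ] (u : List σ) (j n : ℕ) :
    (wset (j * u.length + n) (NotOcc 0 (j * u.length) u)).ncard ≤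
      (Fintype.card σ ^ u.length - 1) ^ j * Fintype.card σ ^ n := by
  induction j with
  | zero =>
    simp only [zero_mul, zero_add, pow_zero, one_mul]
    rw [← wset_true]
    exact wset_mono _ (fun _ _ _ => trivial)
  | succ j ih =>
    have e : (j + 1) * u.length + n = u.length + (j * u.length + n) := by ring
    rw [e]
    have h1 : (wset u.length (fun w => w ≠ u)).ncard ≤ Fintype.card σ ^ u.length - 1 := by
      have hu : u ∈ wset u.length (fun _ : List σ => True) := ⟨rfl, trivial⟩
      rw [← wset_true (σ := σ), ← Set.ncard_sdiff_singleton_of_mem hu]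
      exact Set.ncard_le_ncard (fun w hw => ⟨⟨hw.1, trivial⟩, hw.2⟩)
        ((wset_finite _ _).subset Set.sdiff_subset)
    calc _ ≤ (wset u.length (fun w => w ≠ u)).ncard *
          (wset (j * u.length + n) (NotOcc 0 (j * u.length) u)).ncard := by
          apply wset_append
          intro x y hx hy h
          constructor
          · rintro rfl
            have := h [] y (by simp) (by simp)
            simp at this
          · intro a b hab _
            have := h (x ++ a) b (by simp [hab]) (by simp)
            simp only [List.length_append] at this
            rw [add_mul] at this
            omega
      _ ≤ (Fintype.card σ ^ u.length - 1) *
            ((Fintype.card σ ^ u.length - 1) ^ j * Fintype.card σ ^ n) :=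
          Nat.mul_le_mul h1 ih
      _ = _ := by ring

theorem notOcc_card [Fintype σ] (u : List σ) (s j n : ℕ) :
    (wset (s + (j * u.length + n)) (NotOcc s (j * u.length) u)).ncard ≤
      Fintype.card σ ^ s * ((Fintype.card σ ^ u.length - 1) ^ j * Fintype.card σ ^ n) := by
  refine le_trans (wset_append s _ (p1 := fun _ => True) (p2 := NotOcc 0 (j * u.length) u) ?_) ?_
  · intro x y hx hy h
    refine ⟨trivial, fun a b hab _ => ?_⟩
    have := h (x ++ a) b (by simp [hab]) (by simp [hx])
    simp only [List.length_append] at this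
    omega
  · rw [wset_true]
    exact Nat.mul_le_mul le_rfl (notOcc_step u j n)

theorem occ_all [Fintype σ] (hq : 2 ≤ Fintype.card σ) (s K : ℕ) (ε : ℝ) (hε : 0 < ε) :
    ∃ G : ℕ, ∀ᶠ n : ℕ in atTop,
      ((wset n (fun w : List σ => ∃ u : List σ, u.length = K ∧ NotOcc s G u w)).ncard : ℝ) ≤
        ε * (Fintype.card σ : ℝ) ^ n := by
  set q := Fintype.card σ with hqd
  have hq0 : (0 : ℝ) < q := by positivity
  have hqK : (0 : ℝ) < (q : ℝ) ^ K := by positivity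
  set ρ : ℝ := ((q : ℝ) ^ K - 1) / (q : ℝ) ^ K with hρ
  have h1K : (1 : ℝ) ≤ (q : ℝ) ^ K := one_le_pow₀ (by exact_mod_cast (by omega : 1 ≤ q))
  have hρ0 : 0 ≤ ρ := div_nonneg (by linarith) hqK.le
  have hρ1 : ρ < 1 := by rw [hρ, div_lt_one hqK]; linarith
  obtain ⟨j, hj⟩ := exists_pow_lt_of_lt_one (show 0 < ε / (q : ℝ) ^ K by positivity) hρ1
  refine ⟨j * K, ?_⟩
  filter_upwards [eventually_ge_atTop (s + j * K)] with n hn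
  obtain ⟨n', rfl⟩ : ∃ n', n = s + (j * K + n') := ⟨n - (s + j * K), by omega⟩
  have hU : ∀ u : List σ, u.length = K →
      ((wset (s + (j * K + n')) (NotOcc s (j * K) u)).ncard : ℝ) ≤
        ρ ^ j * (q : ℝ) ^ (s + (j * K + n')) := by
    rintro u rfl
    have := notOcc_card u s j n'
    have h2 : ((wset (s + (j * u.length + n')) (NotOcc s (j * u.length) u)).ncard : ℝ) ≤
      ((q ^ s * ((q ^ u.length - 1) ^ j * q ^ n') : ℕ) : ℝ) := by exact_mod_cast this
    refine h2.trans (le_of_eq ?_)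
    rw [hρ, div_pow]
    push_cast [Nat.cast_sub (show 1 ≤ q ^ u.length from Nat.one_le_pow _ _ (by omega))]
    rw [pow_add, pow_add, mul_comm j, pow_mul]
    field_simp
  have hsub : wset (s + (j * K + n')) (fun w : List σ => ∃ u : List σ, u.length = K ∧
      NotOcc s (j * K) u w) ⊆ ⋃ u ∈ (wset_finite K (fun _ : List σ => True)).toFinset,
        wset (s + (j * K + n')) (NotOcc s (j * K) u) := by
    rintro w ⟨hw, u, hu, h⟩
    simp only [Set.mem_iUnion]
    exact ⟨u, by simp [wset, hu], hw, h⟩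
  have hfin := Set.Finite.biUnion (wset_finite K (fun _ : List σ => True)).toFinset.finite_toSet
      (t := fun u => wset (s + (j * K + n')) (NotOcc s (j * K) u)) (fun u _ => wset_finite _ _)
  have hc := (Set.ncard_le_ncard hsub hfin).trans (Finset.set_ncard_biUnion_le _ _)
  calc _ ≤ ((∑ u ∈ (wset_finite K (fun _ : List σ => True)).toFinset,
        (wset (s + (j * K + n')) (NotOcc s (j * K) u)).ncard : ℕ) : ℝ) := by exact_mod_cast hc
    _ ≤ ∑ u ∈ (wset_finite K (fun _ : List σ => True)).toFinset,
        ρ ^ j * (q : ℝ) ^ (s + (j * K + n')) := by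
        push_cast
        refine Finset.sum_le_sum (fun u hu => hU u ?_)
        simpa [wset] using hu
    _ = (q : ℝ) ^ K * (ρ ^ j * (q : ℝ) ^ (s + (j * K + n'))) := by
        rw [Finset.sum_const, ← Set.ncard_eq_toFinset_card _ (wset_finite K (fun _ : List σ => True)), wset_true, nsmul_eq_mul]
        push_cast; rfl
    _ ≤ ε * (q : ℝ) ^ (s + (j * K + n')) := by
        rw [← mul_assoc]
        refine mul_le_mul_of_nonneg_right ?_ (by positivity)
        rw [lt_div_iff₀ hqK] at hj
        linarith

theorem flatten_len_le (φ : α → List σ) (H : ℕ) (h : ∀ a, (φ a).length ≤ H) (P : List α) :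
    ((P.map φ).flatten).length ≤ P.length * H := by
  induction P with
  | nil => simp
  | cons a P ih => simp only [List.map_cons, List.flatten_cons, List.length_append,
      List.length_cons]; have := h a; rw [add_mul]; omega

theorem map_update_eq [DecidableEq α] (φ : α → List σ) (t : α) (d : List σ) (P : List α)
    (h : t ∉ P) : P.map (Function.update φ t d) = P.map φ := by
  apply List.map_congr_left
  intro a ha
  rw [Function.update_of_ne]
  rintro rfl
  exact h ha

theorem short_step [DecidableEq α] [Fintype σ] (hq : 2 ≤ Fintype.card σ) (P1 P2 Q : List α) (t : α)
    (h1 : t ∉ P1) (h2 : t ∉ P2) (h3 : t ∉ Q) (hS : Short σ P1 Q) :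
    Short σ (P1 ++ t :: P2) Q := by
  intro ε hε
  obtain ⟨H, hH⟩ := hS (ε / 2) (by positivity)
  obtain ⟨G, hG⟩ := occ_all hq (P1.length * H + 1) (P2.length * H) (ε / 2) (by positivity)
  refine ⟨max H (P1.length * H + 1 + G), ?_⟩
  have : Nonempty σ := Fintype.card_pos_iff.1 (by omega)
  obtain ⟨c⟩ := this
  filter_upwards [hH, hG, eventually_ge_atTop
    (P1.length * H + 1 + G + P2.length * H + Q.length * H)] with n a1 a2 hn
  have key := wset_mono n (p := fun w : List σ => Bdry (P1 ++ t :: P2) Q w ∧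
      ¬ BdryH (P1 ++ t :: P2) Q (max H (P1.length * H + 1 + G)) w)
    (q := fun w : List σ => (Bdry P1 Q w ∧ ¬ BdryH P1 Q H w) ∨
      ∃ u : List σ, u.length = P2.length * H ∧ NotOcc (P1.length * H + 1) G u w) ?_
  · have k2 := key.trans (wset_or n _ _)
    have k3 : ((wset n (fun w : List σ => Bdry (P1 ++ t :: P2) Q w ∧
      ¬ BdryH (P1 ++ t :: P2) Q (max H (P1.length * H + 1 + G)) w)).ncard : ℝ) ≤ _ :=
      Nat.cast_le.2 k2
    push_cast at k3
    linarith
  · rintro w hw ⟨⟨φ, hφ, m, hm⟩, hn2⟩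
    by_contra hcon
    push Not at hcon
    obtain ⟨hc1, hc2⟩ := hcon
    have hb : Bdry P1 Q w := ⟨φ, hφ, φ t ++ ((P2.map φ).flatten ++ m), by simp [hm]⟩
    obtain ⟨ψ, hψ, hψH, m', hm'⟩ := hc1 hb
    have l1 := flatten_len_le ψ H hψH P1
    have l2 := flatten_len_le ψ H hψH P2
    have l3 := flatten_len_le ψ H hψH Q
    set pad : List σ := List.replicate (P2.length * H - ((P2.map ψ).flatten).length) c with hpad
    have h4 := hc2 ((P2.map ψ).flatten ++ pad) (by simp only [hpad, List.length_append, List.length_replicate]; omega)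
    unfold NotOcc at h4
    push Not at h4
    obtain ⟨a, b, hab, ha1, ha2⟩ := h4
    have hlen : w.length = a.length + (P2.length * H + b.length) := by
      rw [hab]; simp only [hpad, List.length_append, List.length_replicate]; omega
    have hp : (P1.map ψ).flatten <+: a :=
      List.prefix_of_prefix_length_le (l₃ := w) ⟨_, hm'.symm⟩ ⟨_, hab.symm⟩ (by omega)
    have hs : (Q.map ψ).flatten <:+ b :=
      List.suffix_of_suffix_length_le (l₃ := w) ⟨(P1.map ψ).flatten ++ m', by simp [hm']⟩
        ⟨a ++ ((P2.map ψ).flatten ++ pad), by simp [hab]⟩ (by omega)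
    obtain ⟨d, rfl⟩ := hp
    obtain ⟨e, rfl⟩ := hs
    have hd : d ≠ [] := by
      rintro rfl
      simp only [List.append_nil] at ha1
      omega
    apply hn2
    refine ⟨Function.update ψ t d, ?_, ?_, pad ++ e, ?_⟩
    · intro x
      by_cases hx : x = t
      · subst hx; simpa using hd
      · simpa [Function.update_of_ne hx] using hψ x
    · intro x
      by_cases hx : x = t
      · subst hx
        simp only [List.length_append] at ha2
        simp only [Function.update_self]
        omega
      · rw [Function.update_of_ne hx]
        exact (hψH x).trans (le_max_left _ _)
    · simp only [List.map_append, List.map_cons, map_update_eq ψ t d _ h1,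
        map_update_eq ψ t d _ h2, map_update_eq ψ t d _ h3, Function.update_self]
      simp [hab]

theorem flatten_rev (φ : α → List σ) (P : List α) :
    (P.reverse.map (fun a => (φ a).reverse)).flatten = ((P.map φ).flatten).reverse := by
  induction P with
  | nil => simp
  | cons a P ih => rw [List.reverse_cons, List.map_append, List.flatten_append, ih]; simp

theorem bdry_rev (P Q : List α) (w : List σ) (h : Bdry P Q w) :
    Bdry Q.reverse P.reverse w.reverse := by
  obtain ⟨φ, h1, m, rfl⟩ := h
  refine ⟨fun a => (φ a).reverse, by simpa using h1, m.reverse, ?_⟩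
  simp only [flatten_rev]; simp

theorem bdryH_rev (P Q : List α) (H : ℕ) (w : List σ) (h : BdryH P Q H w) :
    BdryH Q.reverse P.reverse H w.reverse := by
  obtain ⟨φ, h1, h2, m, rfl⟩ := h
  refine ⟨fun a => (φ a).reverse, by simpa using h1, by simpa using h2, m.reverse, ?_⟩
  simp only [flatten_rev]; simp

theorem short_rev [Fintype σ] (P Q : List α) (h : Short σ Q.reverse P.reverse) : Short σ P Q := by
  intro ε hε
  obtain ⟨H, hH⟩ := h ε hε
  refine ⟨H, ?_⟩
  filter_upwards [hH] with n hn
  refine le_trans ?_ hn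
  rw [← wset_reverse]
  refine Nat.cast_le.2 (wset_mono n ?_)
  rintro w - ⟨h1, h2⟩
  refine ⟨by simpa using bdry_rev _ _ _ h1, fun h3 => h2 ?_⟩
  simpa using bdryH_rev _ _ _ _ h3

theorem geom_bound_s8 (y : ℝ) (h0 : 0 ≤ y) (h : y ≤ 1 / 2) (H n : ℕ) :
    ∑ i ∈ Finset.Ioc H n, y ^ i ≤ y ^ H := by
  rcases le_total n H with hn | hn
  · rw [Finset.Ioc_eq_empty_of_le hn]; simp; positivity
  · have : ∑ i ∈ Finset.Ioc H n, y ^ i + y ^ n ≤ y ^ H := by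
      induction n, hn using Nat.le_induction with
      | base => simp
      | succ n hn ih =>
        rw [← Finset.insert_Ioc_right_eq_Ioc_add_one hn, Finset.sum_insert (by simp)]
        have : 0 ≤ y ^ n := by positivity
        rw [pow_succ]
        nlinarith
    have h2 : 0 ≤ y ^ n := by positivity
    linarith

/-- Words `φ(P) m φ(Q)` of length `n` with prescribed image lengths. -/
def LenSet [DecidableEq α] (P Q : List α) (n : ℕ) (l : (P ++ Q).toFinset → ℕ) : Set (List σ) :=
  {w | w.length = n ∧ ∃ φ : α → List σ, (∀ a, (φ a.1).length = l a) ∧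
    ∃ m, w = (P.map φ).flatten ++ (m ++ (Q.map φ).flatten)}

theorem lenSet_card [DecidableEq α] [Fintype σ] (hq : 2 ≤ Fintype.card σ) (P Q : List α)
    (hD : Doubled (P ++ Q)) (n : ℕ) (l : (P ++ Q).toFinset → ℕ) :
    ((LenSet (σ := σ) P Q n l).ncard : ℝ) ≤
      (Fintype.card σ : ℝ) ^ n * ∏ a, (1 / (Fintype.card σ : ℝ)) ^ l a := by
  classical
  set q := Fintype.card σ with hqd
  have hq0 : (0 : ℝ) < q := by positivity
  set S := ∑ a, l a with hSd
  -- total length of fixed part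
  have hlen : ∀ (φ : α → List σ), (∀ a : (P ++ Q).toFinset, (φ a.1).length = l a) →
      2 * S ≤ ((P.map φ).flatten).length + ((Q.map φ).flatten).length ∧
      ((P.map φ).flatten).length + ((Q.map φ).flatten).length =
        ∑ a, (P ++ Q).count a.1 * l a := by
    intro φ hφ
    have e : ((P.map φ).flatten).length + ((Q.map φ).flatten).length =
        ∑ a, (P ++ Q).count a.1 * l a := by
      have e1 : ((P.map φ).flatten).length + ((Q.map φ).flatten).length =
          ((P ++ Q).map (fun a => (φ a).length)).sum := by
        simp [List.length_flatten, Function.comp_def]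
      rw [e1, Finset.sum_list_map_count, ← Finset.sum_coe_sort]
      simp only [smul_eq_mul, hφ]
    refine ⟨?_, e⟩
    rw [e, hSd, Finset.mul_sum]
    refine Finset.sum_le_sum (fun a _ => Nat.mul_le_mul (hD _ ?_) le_rfl)
    simpa using a.2
  set T := ∑ a, (P ++ Q).count a.1 * l a with hT
  by_cases hne : (LenSet (σ := σ) P Q n l).Nonempty
  · obtain ⟨w, hw, φ, hφ, m, hm⟩ := hne
    obtain ⟨h1, h2⟩ := hlen φ hφ
    have hTn : T ≤ n := by
      rw [← hw, hm]; simp only [List.length_append]; omega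
    let ext : (∀ a : (P ++ Q).toFinset, Fin (l a) → σ) → α → List σ :=
      fun f a => if h : a ∈ (P ++ Q).toFinset then List.ofFn (f ⟨a, h⟩) else []
    let F : (∀ a : (P ++ Q).toFinset, Fin (l a) → σ) × (Fin (n - T) → σ) → List σ :=
      fun z => (P.map (ext z.1)).flatten ++ (List.ofFn z.2 ++ (Q.map (ext z.1)).flatten)
    have hsub : LenSet (σ := σ) P Q n l ⊆ F '' Set.univ := by
      rintro w ⟨hw, φ, hφ, m, hm⟩
      obtain ⟨h1, h2⟩ := hlen φ hφ
      have hml : m.length = n - T := by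
        rw [← hw, hm]; simp only [List.length_append]; omega
      refine ⟨(fun a i => (φ a.1).get (i.cast (hφ a).symm), fun i => m.get (i.cast hml.symm)),
        trivial, ?_⟩
      have hext : ∀ a ∈ P ++ Q, ext (fun a i => (φ a.1).get (i.cast (hφ a).symm)) a = φ a := by
        intro a ha
        have ha' : a ∈ (P ++ Q).toFinset := by simpa using ha
        simp only [ext, dif_pos ha']
        apply List.ext_get
        · simp [hφ ⟨a, ha'⟩]
        · intro i _ _; simp
      have hm2 : List.ofFn (fun i : Fin (n - T) => m.get (i.cast hml.symm)) = m := by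
        apply List.ext_get
        · simp [hml]
        · intro i _ _; simp
      simp only [F]
      rw [hm2, hm, List.map_congr_left (fun a ha => hext a (List.mem_append_left _ ha)),
        List.map_congr_left (fun a ha => hext a (List.mem_append_right _ ha))]
    have hc : (LenSet (σ := σ) P Q n l).ncard ≤ q ^ S * q ^ (n - T) := by
      refine (Set.ncard_le_ncard hsub (Set.toFinite _)).trans
        ((Set.ncard_image_le (Set.toFinite _)).trans (le_of_eq ?_))
      rw [Set.ncard_univ, Nat.card_eq_fintype_card, Fintype.card_prod, Fintype.card_pi]
      simp [Finset.prod_pow_eq_pow_sum, hSd, hqd]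
    have hc2 : (LenSet (σ := σ) P Q n l).ncard ≤ q ^ (n - S) := by
      refine hc.trans ?_
      rw [← pow_add]
      exact Nat.pow_le_pow_right (by omega) (by omega)
    rw [Finset.prod_pow_eq_pow_sum, ← hSd, one_div, inv_pow, ← div_eq_mul_inv,
      le_div_iff₀ (by positivity)]
    calc _ ≤ ((q : ℝ) ^ (n - S)) * (q : ℝ) ^ S :=
          mul_le_mul_of_nonneg_right (by exact_mod_cast hc2) (by positivity)
      _ = (q : ℝ) ^ n := by rw [← pow_add]; congr 1; omega
  · rw [Set.not_nonempty_iff_eq_empty.1 hne]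
    simp
    positivity

theorem short_base [DecidableEq α] [Fintype σ] (hq : 2 ≤ Fintype.card σ) (P Q : List α)
    (hD : Doubled (P ++ Q)) : Short σ P Q := by
  classical
  intro ε hε
  set q := Fintype.card σ with hqd
  have hq0 : (0 : ℝ) < q := by positivity
  have hq2 : (2 : ℝ) ≤ q := by exact_mod_cast hq
  set y : ℝ := 1 / q with hy
  have hy0 : 0 < y := by positivity
  have hy2 : y ≤ 1 / 2 := by rw [hy]; gcongr
  set k := Fintype.card (P ++ Q).toFinset with hk
  obtain ⟨H, hH⟩ := exists_pow_lt_of_lt_one (show 0 < ε / (k + 1) by positivity)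
    (show y < 1 by linarith)
  refine ⟨H + 1, Eventually.of_forall fun n => ?_⟩
  have : Nonempty σ := Fintype.card_pos_iff.1 (by omega)
  obtain ⟨c⟩ := this
  let I : (P ++ Q).toFinset → (P ++ Q).toFinset → Finset ℕ := fun a0 a =>
    Finset.Ioc (if a = a0 then H else 0) n
  have hsub : wset n (fun w : List σ => Bdry P Q w ∧ ¬ BdryH P Q (H + 1) w) ⊆
      ⋃ p ∈ (Finset.univ : Finset (P ++ Q).toFinset).sigma
        (fun a0 => Fintype.piFinset (I a0)), LenSet (σ := σ) P Q n p.2 := by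
    rintro w ⟨hw, ⟨φ, hφ, m, hm⟩, hn⟩
    have hex : ∃ a0 : (P ++ Q).toFinset, H < (φ a0.1).length := by
      by_contra hcon
      push Not at hcon
      apply hn
      have hag : ∀ a ∈ P ++ Q, (if a ∈ P ++ Q then φ a else [c]) = φ a := by
        intro a ha; rw [if_pos ha]
      refine ⟨fun a => if a ∈ P ++ Q then φ a else [c], ?_, ?_, m, ?_⟩
      · intro a
        dsimp only
        split_ifs
        · exact hφ a
        · simp
      · intro a
        dsimp only
        split_ifs with h
        · have := hcon ⟨a, by simpa using h⟩
          dsimp only at this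
          omega
        · simp
      · rw [List.map_congr_left (fun a ha => hag a (List.mem_append_left _ ha)),
          List.map_congr_left (fun a ha => hag a (List.mem_append_right _ ha)), hm]
    obtain ⟨a0, ha0⟩ := hex
    simp only [Set.mem_iUnion]
    refine ⟨⟨a0, fun a => (φ a.1).length⟩, ?_, hw, φ, fun a => rfl, m, hm⟩
    simp only [Finset.mem_sigma, Finset.mem_univ, true_and, Fintype.mem_piFinset, I,
      Finset.mem_Ioc]
    intro a
    constructor
    · split_ifs with h
      · rw [h]; exact ha0
      · exact List.length_pos_iff.2 (hφ _)
    · have hmem : a.1 ∈ P ++ Q := by simpa using a.2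
      have hle : ∀ R : List α, a.1 ∈ R → (φ a.1).length ≤ ((R.map φ).flatten).length := by
        intro R hR
        exact (List.sublist_flatten_of_mem (List.mem_map_of_mem hR)).length_le
      have hl : w.length = ((P.map φ).flatten).length + (m.length + ((Q.map φ).flatten).length) := by
        rw [hm]; simp only [List.length_append]
      rcases List.mem_append.1 hmem with h | h
      · have := hle P h; omega
      · have := hle Q h; omega
  have hfin : ∀ l, (LenSet (σ := σ) P Q n l).Finite := fun l =>
    (List.finite_length_eq σ n).subset (fun _ h => h.1)
  have hc := (Set.ncard_le_ncard hsub (Set.Finite.biUnion (Finset.finite_toSet _)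
    (fun _ _ => hfin _))).trans (Finset.set_ncard_biUnion_le _ _)
  calc _ ≤ ((∑ p ∈ (Finset.univ : Finset (P ++ Q).toFinset).sigma
        (fun a0 => Fintype.piFinset (I a0)), (LenSet (σ := σ) P Q n p.2).ncard : ℕ) : ℝ) :=
        Nat.cast_le.2 hc
    _ ≤ ∑ p ∈ (Finset.univ : Finset (P ++ Q).toFinset).sigma
        (fun a0 => Fintype.piFinset (I a0)), (q : ℝ) ^ n * ∏ a, y ^ p.2 a := by
        push_cast
        exact Finset.sum_le_sum (fun p _ => lenSet_card hq P Q hD n p.2)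
    _ = (q : ℝ) ^ n * ∑ a0, ∏ a, ∑ i ∈ I a0 a, y ^ i := by
        rw [Finset.sum_sigma, Finset.mul_sum]
        refine Finset.sum_congr rfl (fun a0 _ => ?_)
        rw [Finset.prod_univ_sum, Finset.mul_sum]
    _ ≤ (q : ℝ) ^ n * ∑ a0 : (P ++ Q).toFinset, y ^ H := by
        refine mul_le_mul_of_nonneg_left (Finset.sum_le_sum fun a0 _ => ?_) (by positivity)
        calc _ ≤ ∏ a, y ^ (if a = a0 then H else 0) :=
              Finset.prod_le_prod (fun a _ => Finset.sum_nonneg fun i _ => by positivity)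
                (fun a _ => geom_bound_s8 y hy0.le hy2 _ _)
          _ = y ^ H := by
              rw [Finset.prod_pow_eq_pow_sum]; simp
    _ ≤ ε * (q : ℝ) ^ n := by
        rw [Finset.sum_const, Finset.card_univ, ← hk, nsmul_eq_mul, mul_comm]
        refine mul_le_mul_of_nonneg_right ?_ (by positivity)
        rw [lt_div_iff₀ (by positivity)] at hH
        have : 0 ≤ y ^ H := by positivity
        nlinarith

theorem short_all [DecidableEq α] [Fintype σ] (hq : 2 ≤ Fintype.card σ) (N : ℕ) :
    ∀ P Q : List α, P.length + Q.length = N → Short σ P Q := by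
  induction N using Nat.strong_induction_on with
  | _ N ih =>
    intro P Q hN
    by_cases hD : Doubled (P ++ Q)
    · exact short_base hq P Q hD
    · unfold Doubled at hD
      push Not at hD
      obtain ⟨t, ht, hc⟩ := hD
      rw [List.count_append] at hc
      rcases List.mem_append.1 ht with h | h
      · obtain ⟨P1, P2, rfl⟩ := List.append_of_mem h
        simp only [List.count_append, List.count_cons_self] at hc
        refine short_step hq P1 P2 Q t (List.count_eq_zero.1 (by omega))
          (List.count_eq_zero.1 (by omega)) (List.count_eq_zero.1 (by omega))
          (ih _ ?_ P1 Q rfl)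
        simp only [List.length_append, List.length_cons] at hN
        omega
      · obtain ⟨Q1, Q2, rfl⟩ := List.append_of_mem h
        simp only [List.count_append, List.count_cons_self] at hc
        apply short_rev
        have e : (Q1 ++ t :: Q2).reverse = Q2.reverse ++ t :: Q1.reverse := by simp
        rw [e]
        refine short_step hq _ _ _ t
          (by rw [List.mem_reverse]; exact List.count_eq_zero.1 (by omega))
          (by rw [List.mem_reverse]; exact List.count_eq_zero.1 (by omega))
          (by rw [List.mem_reverse]; exact List.count_eq_zero.1 (by omega))
          (ih (Q2.reverse.length + P.reverse.length) ?_ _ _ rfl)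
        simp only [List.length_append, List.length_cons] at hN
        simp only [List.length_reverse]
        omega

theorem inst_lower [DecidableEq α] [Fintype σ] (hq : 2 ≤ Fintype.card σ) (P Q : List α) (t : α)
    (h1 : t ∉ P) (h2 : t ∉ Q) (n : ℕ) :
    Fintype.card σ ^ (n + 1) ≤
      (wset (P.length + Q.length + (n + 1)) (fun w : List σ => IsInstance (P ++ t :: Q) w)).ncard := by
  have : Nonempty σ := Fintype.card_pos_iff.1 (by omega)
  obtain ⟨c⟩ := this
  rw [← wset_true (σ := σ)]
  refine Set.ncard_le_ncard_of_injOn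
    (fun m => List.replicate P.length c ++ (m ++ List.replicate Q.length c)) ?_ ?_ (wset_finite _ _)
  · rintro m ⟨hm, -⟩
    refine ⟨by simp only [List.length_append, List.length_replicate]; omega,
      Function.update (fun _ => [c]) t m, ?_, ?_⟩
    · intro a
      by_cases h : a = t
      · subst h
        rw [Function.update_self]
        rintro rfl
        simp at hm
      · simp [Function.update_of_ne h]
    · have hr : ∀ R : List α, (R.map (fun _ => [c])).flatten = List.replicate R.length c := by
        intro R
        induction R with
        | nil => simp
        | cons a R ih => simp only [List.map_cons, List.flatten_cons, ih]; rfl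
      simp only [List.map_append, List.map_cons, map_update_eq _ t m _ h1,
        map_update_eq _ t m _ h2, Function.update_self, List.flatten_append, List.flatten_cons, hr]
  · intro a _ b _ h
    simpa using h

theorem main_gen [DecidableEq α] [Fintype σ] (hq : 2 ≤ Fintype.card σ) (P Q : List α) (t : α)
    (h1 : t ∉ P) (h2 : t ∉ Q) :
    Tendsto (fun n : ℕ =>
        ((wset n (fun w : List σ => ∃ φ : α → List σ, (∀ a, φ a ≠ []) ∧
            w = ((P ++ t :: Q).map φ).flatten ∧
            (n : ℝ) - Real.sqrt n < ((φ t).length : ℝ))).ncard : ℝ) /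
          ((wset n (fun w : List σ => IsInstance (P ++ t :: Q) w)).ncard : ℝ))
        atTop (nhds 1) := by
  set q := Fintype.card σ with hqd
  have hq0 : (0 : ℝ) < q := by positivity
  set C := P.length + Q.length with hC
  rw [Metric.tendsto_atTop']
  intro ε hε
  obtain ⟨H, hH⟩ := short_all (σ := σ) hq _ P Q rfl (ε / 2 / (q : ℝ) ^ C) (by positivity)
  obtain ⟨N, hN⟩ := eventually_atTop.1 hH
  refine ⟨max N (max C ((C * H) ^ 2)), fun n hn => ?_⟩
  have hn1 : N ≤ n := by have := le_max_left N (max C ((C * H) ^ 2)); omega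
  have hn2 : C < n := by
    have := le_max_right N (max C ((C * H) ^ 2))
    have := le_max_left C ((C * H) ^ 2); omega
  have hn3 : (C * H) ^ 2 < n := by
    have := le_max_right N (max C ((C * H) ^ 2))
    have := le_max_right C ((C * H) ^ 2); omega
  have hsq : ((C * H : ℕ) : ℝ) < Real.sqrt n := by
    apply Real.lt_sqrt_of_sq_lt
    exact_mod_cast hn3
  have hsqn : Real.sqrt n ≤ n := by
    rw [Real.sqrt_le_left (by positivity)]
    have : (1 : ℝ) ≤ n := by exact_mod_cast (by omega : 1 ≤ n)
    nlinarith
  have hCHn : C * H < n := by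
    have := hsq.trans_le hsqn
    exact_mod_cast this
  set A := wset n (fun w : List σ => ∃ φ : α → List σ, (∀ a, φ a ≠ []) ∧
            w = ((P ++ t :: Q).map φ).flatten ∧
            (n : ℝ) - Real.sqrt n < ((φ t).length : ℝ)) with hA
  set B := wset n (fun w : List σ => IsInstance (P ++ t :: Q) w) with hB
  have hAB : A.ncard ≤ B.ncard := by
    apply wset_mono
    rintro w _ ⟨φ, a, b, _⟩
    exact ⟨φ, a, b⟩
  have hBA : B.ncard ≤ A.ncard + (wset n (fun w : List σ => Bdry P Q w ∧ ¬ BdryH P Q H w)).ncard := by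
    refine le_trans (wset_mono n ?_) (wset_or n _ _)
    rintro w hw ⟨φ, hφ, hwφ⟩
    by_cases hb : BdryH P Q H w
    · left
      obtain ⟨ψ, hψ, hψH, m, hm⟩ := hb
      have l1 := flatten_len_le ψ H hψH P
      have l3 := flatten_len_le ψ H hψH Q
      have hl : w.length = ((P.map ψ).flatten).length + (m.length + ((Q.map ψ).flatten).length) := by
        rw [hm]; simp only [List.length_append]
      have hCH : C * H = P.length * H + Q.length * H := by rw [hC, add_mul]
      have hml : n ≤ m.length + C * H := by omega
      have hm0 : m ≠ [] := by
        rintro rfl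
        simp only [List.length_nil] at hml
        omega
      refine ⟨Function.update ψ t m, ?_, ?_, ?_⟩
      · intro x
        by_cases hx : x = t
        · subst hx; simpa using hm0
        · simpa [Function.update_of_ne hx] using hψ x
      · simp only [List.map_append, List.map_cons, map_update_eq ψ t m _ h1,
          map_update_eq ψ t m _ h2, Function.update_self]
        simp [hm]
      · rw [Function.update_self]
        have : (n : ℝ) ≤ m.length + (C * H : ℕ) := by exact_mod_cast hml
        linarith
    · right
      refine ⟨⟨φ, hφ, φ t, ?_⟩, hb⟩
      rw [hwφ]; simp
  have hbad := hN n hn1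
  have hlow : q ^ (n - C) ≤ B.ncard := by
    have := inst_lower (σ := σ) hq P Q t h1 h2 (n - C - 1)
    rw [← hC, show n - C - 1 + 1 = n - C by omega, show C + (n - C) = n by omega] at this
    exact this
  have hlowR : (q : ℝ) ^ (n - C) ≤ B.ncard := by exact_mod_cast hlow
  have hBpos : (0 : ℝ) < B.ncard := lt_of_lt_of_le (by positivity) hlowR
  have hABR : (A.ncard : ℝ) ≤ B.ncard := by exact_mod_cast hAB
  have hBAR : (B.ncard : ℝ) ≤ A.ncard +
      (wset n (fun w : List σ => Bdry P Q w ∧ ¬ BdryH P Q H w)).ncard := by exact_mod_cast hBA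
  have e : ε / 2 / (q : ℝ) ^ C * (q : ℝ) ^ n = ε / 2 * (q : ℝ) ^ (n - C) := by
    have : (q : ℝ) ^ n = (q : ℝ) ^ (n - C) * (q : ℝ) ^ C := by
      rw [← pow_add]; congr 1; omega
    rw [this]; field_simp
  rw [e] at hbad
  have hfin : (B.ncard : ℝ) - A.ncard ≤ ε / 2 * B.ncard := by
    have : ε / 2 * (q : ℝ) ^ (n - C) ≤ ε / 2 * B.ncard :=
      mul_le_mul_of_nonneg_left hlowR (by positivity)
    linarith
  rw [Real.dist_eq, abs_lt]
  constructor
  · have : 1 - ε / 2 ≤ (A.ncard : ℝ) / B.ncard := by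
      rw [le_div_iff₀ hBpos]; linarith
    linarith
  · have : (A.ncard : ℝ) / B.ncard ≤ 1 := by
      rw [div_le_one hBpos]; exact hABR
    linarith

end Helpers

/-- Let `V = U_0 x_1 U_1 x_2 ⋯ x_r U_r` with `r ≥ 1`, where `U = U_0 U_1 ⋯ U_r`
is doubled, the `x_i` are distinct and none occurs in `U`, and let `|Σ| = q ≥ 2`.
Then there is a nondecreasing function `g(n) = o(n)` such that the proportion of
`V`-instances `W ∈ Σ^n` admitting a nonerasing homomorphism `φ` with `φ(V) = W`
and `|φ(x_r)| > n - g(n)` tends to 1 as `n → ∞`. -/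
theorem stmt8 {α σ : Type*} [DecidableEq α] [Fintype σ]
    (r : ℕ) (hr : 1 ≤ r) (U : Fin (r + 1) → List α) (x : Fin r → α)
    (hx : Function.Injective x)
    (hxU : ∀ i j, x i ∉ U j)
    (hU : Doubled (List.ofFn U).flatten)
    (hq : 2 ≤ Fintype.card σ)
    (V : List α)
    (hV : V = U 0 ++ (List.ofFn fun i : Fin r => x i :: U i.succ).flatten) :
    ∃ g : ℕ → ℝ, Monotone g ∧
      Tendsto (fun n : ℕ => g n / n) atTop (nhds 0) ∧
      Tendsto (fun n : ℕ =>
        (Nat.card {w : Fin n → σ // ∃ φ : α → List σ, (∀ a, φ a ≠ []) ∧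
            List.ofFn w = (V.map φ).flatten ∧
            (n : ℝ) - g n < ((φ (x ⟨r - 1, by omega⟩)).length : ℝ)} : ℝ) /
          (Nat.card {w : Fin n → σ // IsInstance V (List.ofFn w)} : ℝ))
        atTop (nhds 1) := by
  obtain ⟨s, rfl⟩ : ∃ s, r = s + 1 := ⟨r - 1, by omega⟩
  have hlast : (⟨s + 1 - 1, by omega⟩ : Fin (s + 1)) = Fin.last s := rfl
  set P : List α := U 0 ++ (List.ofFn fun i : Fin s => x i.castSucc :: U i.castSucc.succ).flatten
    with hP
  have hVP : V = P ++ x (Fin.last s) :: U (Fin.last s).succ := by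
    rw [hV, List.ofFn_succ_last]
    simp [hP]
  have h1 : x (Fin.last s) ∉ P := by
    rw [hP]
    simp only [List.mem_append, List.mem_flatten, List.mem_ofFn, not_or, not_exists, not_and]
    refine ⟨hxU _ _, ?_⟩
    rintro l ⟨i, rfl⟩ hmem
    rcases List.mem_cons.1 hmem with h | h
    · exact (Fin.castSucc_lt_last i).ne' (hx h)
    · exact hxU _ _ h
  refine ⟨fun n => Real.sqrt n, ?_, ?_, ?_⟩
  · intro a b hab
    exact Real.sqrt_le_sqrt (by exact_mod_cast hab)
  · have : Tendsto (fun n : ℕ => (Real.sqrt n)⁻¹) atTop (nhds 0) :=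
      (Real.tendsto_sqrt_atTop.comp tendsto_natCast_atTop_atTop).inv_tendsto_atTop
    refine this.congr (fun n => ?_)
    rw [Real.sqrt_div_self']
    simp
  · have := main_gen (σ := σ) hq P (U (Fin.last s).succ) (x (Fin.last s)) h1 (hxU _ _)
    rw [← hVP] at this
    refine this.congr (fun n => ?_)
    rw [← wset_card_eq, ← wset_card_eq]
    rfl
end

section
/- Let V be a nondoubled word and Σ a finite nonempty alphabet with q letters. Then the limit I(V,Σ) = lim_{n→∞} I_n(V,Σ) exists, and moreover I(V,Σ) ≥ q^{-||V||} > 0. -/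
open Filter Asymptotics

open Classical in
/-- Indicator of a proposition. -/
noncomputable def ind (p : Prop) : ℝ := if p then 1 else 0

/-- Expectation of `f` over uniformly random words of length `n`. -/
noncomputable def EE (σ : Type*) [Fintype σ] (n : ℕ) (f : List σ → ℝ) : ℝ :=
  (∑ w : Fin n → σ, f (List.ofFn w)) / (Fintype.card σ : ℝ) ^ n

lemma ind_nonneg (p : Prop) : 0 ≤ ind p := by unfold ind; split_ifs <;> norm_num
lemma ind_le_one (p : Prop) : ind p ≤ 1 := by unfold ind; split_ifs <;> norm_num
lemma ind_true {p : Prop} (h : p) : ind p = 1 := by simp [ind, h]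
lemma ind_false {p : Prop} (h : ¬ p) : ind p = 0 := by simp [ind, h]
lemma ind_mono {p q : Prop} (h : p → q) : ind p ≤ ind q := by
  by_cases hp : p
  · rw [ind_true hp, ind_true (h hp)]
  · rw [ind_false hp]; exact ind_nonneg q

section
variable {σ : Type*} [Fintype σ]

lemma EE_mono {n : ℕ} {f g : List σ → ℝ} (h : ∀ l, l.length = n → f l ≤ g l) :
    EE σ n f ≤ EE σ n g := by
  unfold EE
  gcongr with w
  exact h _ (by simp)

lemma EE_congr {n : ℕ} {f g : List σ → ℝ} (h : ∀ l, l.length = n → f l = g l) :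
    EE σ n f = EE σ n g :=
  le_antisymm (EE_mono fun l hl => (h l hl).le) (EE_mono fun l hl => (h l hl).ge)

lemma EE_append (m n : ℕ) (f : List σ → ℝ) :
    EE σ (m + n) f = EE σ m (fun u => EE σ n (fun v => f (u ++ v))) := by
  unfold EE
  rw [← Finset.sum_div, div_div, ← pow_add, add_comm n m, ← Fintype.sum_prod_type',
    ← (Fin.appendEquiv m n).sum_comp]
  congr 1
  apply Finset.sum_congr rfl
  rintro ⟨u, v⟩ _
  simp [Fin.appendEquiv, List.ofFn_fin_append]

lemma EE_add (n : ℕ) (f g : List σ → ℝ) :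
    EE σ n (fun l => f l + g l) = EE σ n f + EE σ n g := by
  simp [EE, Finset.sum_add_distrib, add_div]

lemma EE_sum {ι : Type*} (s : Finset ι) (n : ℕ) (f : ι → List σ → ℝ) :
    EE σ n (fun l => ∑ i ∈ s, f i l) = ∑ i ∈ s, EE σ n (f i) := by
  unfold EE
  rw [Finset.sum_comm, Finset.sum_div]

lemma EE_mul (n : ℕ) (c : ℝ) (f : List σ → ℝ) :
    EE σ n (fun l => f l * c) = EE σ n f * c := by
  simp only [EE, ← Finset.sum_mul]; ring

lemma EE_const [Nonempty σ] (n : ℕ) (c : ℝ) : EE σ n (fun _ => c) = c := by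
  have : (Fintype.card σ : ℝ) ^ n ≠ 0 := by positivity
  simp only [EE, Finset.sum_const, Finset.card_univ, Fintype.card_fun, Fintype.card_fin,
    nsmul_eq_mul, Nat.cast_pow]
  field_simp

lemma EE_nonneg (n : ℕ) {f : List σ → ℝ} (h : ∀ l, 0 ≤ f l) : 0 ≤ EE σ n f :=
  div_nonneg (Finset.sum_nonneg fun _ _ => h _) (by positivity)

lemma EE_eq (n : ℕ) (Y : List σ) (hY : Y.length = n) :
    EE σ n (fun l => ind (l = Y)) = ((Fintype.card σ : ℝ) ^ n)⁻¹ := by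
  classical
  subst hY
  unfold EE
  rw [← one_div]
  congr 1
  rw [Finset.sum_eq_single (fun i => Y.get i)]
  · exact ind_true (List.ofFn_get Y)
  · intro w _ hw
    apply ind_false
    intro h
    apply hw
    apply List.ofFn_injective
    rw [h, List.ofFn_get Y]
  · simp

lemma instProb_eq {α : Type*} (V : List α) (n : ℕ) :
    instProb V σ n = EE σ n (fun l => ind (IsInstance V l)) := by
  classical
  unfold instProb EE ind
  congr 1
  rw [Finset.sum_boole, Nat.card_eq_fintype_card, Fintype.card_subtype]

/-- Containing a fixed factor has probability tending to one. -/
lemma infix_tendsto [Nonempty σ] (Y : List σ) :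
    Tendsto (fun N => EE σ N (fun l => ind (¬ Y <:+: l))) atTop (nhds 0) := by
  set c : ℕ → ℝ := fun N => EE σ N (fun l => ind (¬ Y <:+: l)) with hc
  have hanti : Antitone c := by
    apply antitone_nat_of_succ_le
    intro n
    simp only [hc]
    rw [EE_append n 1]
    apply EE_mono
    intro l _
    calc _ ≤ EE σ 1 (fun _ => ind (¬ Y <:+: l)) := by
          apply EE_mono
          intro v _
          apply ind_mono
          exact fun h h' => h (h'.trans (List.prefix_append _ _).isInfix)
      _ = _ := EE_const _ _
  have h0 : ∀ n, 0 ≤ c n := fun n => EE_nonneg n fun l => ind_nonneg _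
  have hlim := tendsto_atTop_ciInf hanti ⟨0, by rintro _ ⟨n, rfl⟩; exact h0 n⟩
  set L := ⨅ i, c i
  have hL : 0 ≤ L := ge_of_tendsto' hlim h0
  set θ : ℝ := ((Fintype.card σ : ℝ) ^ Y.length)⁻¹ with hθ
  have hθ0 : 0 < θ := by positivity
  have hstep : ∀ n, c (n + Y.length) ≤ (1 - θ) * c n := by
    intro n
    simp only [hc]
    rw [EE_append n Y.length, mul_comm, ← EE_mul]
    apply EE_mono
    intro l _
    have h1 : EE σ Y.length (fun v => ind (¬ v = Y)) = 1 - θ := by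
      have := EE_add Y.length (fun v => ind (¬ v = Y)) (fun v : List σ => ind (v = Y))
      rw [EE_eq _ Y rfl] at this
      rw [← hθ] at this
      have h2 : EE σ Y.length (fun l => ind (¬l = Y) + ind (l = Y)) = 1 := by
        rw [← EE_const (σ := σ) Y.length 1]
        apply EE_congr
        intro l _
        by_cases h : l = Y <;> simp [ind, h]
      linarith
    rw [← h1, mul_comm, ← EE_mul]
    apply EE_mono
    intro v _
    by_cases h : Y <:+: l ++ v
    · rw [ind_false (not_not.2 h)]; exact mul_nonneg (ind_nonneg _) (ind_nonneg _)
    · rw [ind_true h, ind_true, ind_true]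
      · norm_num
      · exact fun h' => h (h'.trans (List.prefix_append _ _).isInfix)
      · rintro rfl; exact h (List.suffix_append _ _).isInfix
  have := le_of_tendsto_of_tendsto' (hlim.comp (tendsto_add_atTop_nat Y.length))
    (hlim.const_mul (1 - θ)) hstep
  have hL0 : L = 0 := by nlinarith
  rw [← hL0]; exact hlim

/-- A word with two disjoint equal factors of length `t`. -/
def RepW (t : ℕ) (W : List σ) : Prop :=
  ∃ A z B C : List σ, z.length = t ∧ W = A ++ (z ++ (B ++ (z ++ C)))

lemma rep_bound [Nonempty σ] (n t : ℕ) :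
    EE σ n (fun l => ind (RepW t l)) ≤
      ((n + 1 : ℕ) : ℝ) * ((n + 1 : ℕ) : ℝ) * ((Fintype.card σ : ℝ) ^ t)⁻¹ := by
  classical
  have key : ∀ a b : ℕ, EE σ n (fun l => ind (∃ A z B C : List σ, A.length = a ∧ B.length = b ∧
      z.length = t ∧ l = A ++ (z ++ (B ++ (z ++ C))))) ≤ ((Fintype.card σ : ℝ) ^ t)⁻¹ := by
    intro a b
    by_cases hn : a + (t + (b + t)) ≤ n
    · obtain ⟨c, rfl⟩ := Nat.exists_eq_add_of_le hn
      rw [show a + (t + (b + t)) + c = a + (t + (b + (t + c))) by omega]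
      rw [EE_append]
      conv_rhs => rw [← EE_const (σ := σ) a ((Fintype.card σ : ℝ) ^ t)⁻¹]
      apply EE_mono
      intro A hA
      rw [EE_append]
      conv_rhs => rw [← EE_const (σ := σ) t ((Fintype.card σ : ℝ) ^ t)⁻¹]
      apply EE_mono
      intro z hz
      rw [EE_append]
      conv_rhs => rw [← EE_const (σ := σ) b ((Fintype.card σ : ℝ) ^ t)⁻¹]
      apply EE_mono
      intro B hB
      rw [EE_append, ← EE_eq t z hz]
      apply EE_mono
      intro z' hz'
      conv_rhs => rw [← EE_const (σ := σ) c (ind (z' = z))]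
      apply EE_mono
      intro C hC
      apply ind_mono
      rintro ⟨A', w, B', C', h1, h2, h3, h4⟩
      obtain ⟨_, h4⟩ := List.append_inj h4 (by omega)
      obtain ⟨e1, h4⟩ := List.append_inj h4 (by omega)
      obtain ⟨_, h4⟩ := List.append_inj h4 (by omega)
      obtain ⟨e2, h4⟩ := List.append_inj h4 (by omega)
      rw [e1, e2]
    · calc _ ≤ EE σ n (fun _ => 0) := by
            apply EE_mono
            intro l hl
            rw [ind_false]
            rintro ⟨A, z, B, C, h1, h2, h3, rfl⟩
            simp at hl
            omega
        _ = 0 := EE_const _ _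
        _ ≤ _ := by positivity
  calc _ ≤ EE σ n (fun l => ∑ p ∈ Finset.range (n + 1) ×ˢ Finset.range (n + 1),
          ind (∃ A z B C : List σ, A.length = p.1 ∧ B.length = p.2 ∧
            z.length = t ∧ l = A ++ (z ++ (B ++ (z ++ C))))) := by
        apply EE_mono
        intro l hl
        by_cases h : RepW t l
        · rw [ind_true h]
          obtain ⟨A, z, B, C, h1, h2⟩ := h
          have hlen := congrArg List.length h2
          simp at hlen
          refine le_trans ?_ (Finset.single_le_sum (fun _ _ => ind_nonneg _)
            (a := (A.length, B.length)) ?_)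
          · rw [ind_true]
            exact ⟨A, z, B, C, rfl, rfl, h1, h2⟩
          · simp only [Finset.mem_product, Finset.mem_range]
            omega
        · rw [ind_false h]
          exact Finset.sum_nonneg fun _ _ => ind_nonneg _
    _ ≤ ∑ p ∈ Finset.range (n + 1) ×ˢ Finset.range (n + 1), ((Fintype.card σ : ℝ) ^ t)⁻¹ := by
        rw [EE_sum]
        exact Finset.sum_le_sum fun p _ => key p.1 p.2
    _ = _ := by simp

end

lemma first_split {α : Type*} (p : α → Prop) (l : List α) (h : ∃ a ∈ l, p a) :
    ∃ A x B, l = A ++ x :: B ∧ p x ∧ ∀ a ∈ A, ¬ p a := by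
  induction l with
  | nil => simp at h
  | cons b l ih =>
    by_cases hb : p b
    · exact ⟨[], b, l, by simp, hb, by simp⟩
    · obtain ⟨A, x, B, rfl, hx, hA⟩ := ih (by
        obtain ⟨a, ha, hpa⟩ := h
        rcases List.mem_cons.1 ha with rfl | ha
        · exact absurd hpa hb
        · exact ⟨a, ha, hpa⟩)
      refine ⟨b :: A, x, B, by simp, hx, ?_⟩
      intro a ha
      rcases List.mem_cons.1 ha with rfl | ha
      · exact hb
      · exact hA a ha

/-- The boundary condition: prefix `P` and suffix `S`. -/
def QQ {α σ : Type*} (U T : List α) (P S : List σ) : Prop :=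
  ∃ φ : α → List σ, (∀ a, φ a ≠ []) ∧ (U.map φ).flatten <+: P ∧ (T.map φ).flatten <:+ S

lemma map_flatten_congr {α σ : Type*} {φ ψ : α → List σ} (V : List α)
    (h : ∀ a ∈ V, φ a = ψ a) : (V.map φ).flatten = (V.map ψ).flatten := by
  rw [List.map_congr_left h]

/-- Splitting off the boundary blocks. -/
lemma decomp {α : Type*} (σ : Type*) [Nonempty σ] [DecidableEq α] (V : List α)
    (hV : ∃ a ∈ V, V.count a = 1) :
    ∃ U M T : List α, V = U ++ (M ++ T) ∧ (∀ a ∈ U, 2 ≤ V.count a) ∧ (∀ a ∈ T, 2 ≤ V.count a) ∧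
      ∀ P S : List σ, QQ U T P S → ∃ Y : List σ, ∀ W, Y <:+: W → IsInstance V (P ++ (W ++ S)) := by
  obtain ⟨U, x, B, hVe, hx, hU⟩ := first_split (fun a => V.count a = 1) V hV
  have two : ∀ a ∈ V, V.count a ≠ 1 → 2 ≤ V.count a := by
    intro a ha h
    have := List.count_pos_iff.2 ha
    omega
  have s : σ := Classical.arbitrary σ
  have hx' := hx
  rw [hVe] at hx'
  simp [List.count_append] at hx'
  have hxU : x ∉ U := by
    intro h; have := List.count_pos_iff.2 h; omega
  have hxB : x ∉ B := by
    intro h; have := List.count_pos_iff.2 h; omega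
  by_cases hB : ∃ a ∈ B, V.count a = 1
  · obtain ⟨T', y, R', hBe, hy, hT⟩ := first_split (fun a => V.count a = 1) B.reverse
      (by simpa using hB)
    have hBe2 : B = R'.reverse ++ y :: T'.reverse := by
      have := congrArg List.reverse hBe
      simpa using this
    obtain ⟨T, rfl⟩ : ∃ T, T' = T.reverse := ⟨T'.reverse, by simp⟩
    obtain ⟨R, rfl⟩ : ∃ R, R' = R.reverse := ⟨R'.reverse, by simp⟩
    simp only [List.reverse_reverse] at hBe2
    subst hBe2
    have hyx : y ≠ x := by rintro rfl; simp at hxB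
    have hy' := hy
    rw [hVe] at hy'
    simp [List.count_append, hyx.symm] at hy'
    have hyU : y ∉ U := by
      intro h; have := List.count_pos_iff.2 h; omega
    have hyR : y ∉ R := by
      intro h; have := List.count_pos_iff.2 h; omega
    have hyT : y ∉ T := by
      intro h; have := List.count_pos_iff.2 h; omega
    simp at hxB
    refine ⟨U, x :: (R ++ [y]), T, by simp [hVe], ?_, ?_, ?_⟩
    · intro a ha
      exact two a (by simp [hVe, ha]) (hU a ha)
    · intro a ha
      exact two a (by simp [hVe, ha]) (hT a (by simpa using ha))
    · rintro P S ⟨φ, hφ, ⟨P', rfl⟩, ⟨S', rfl⟩⟩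
      refine ⟨s :: ((R.map φ).flatten ++ [s]), ?_⟩
      rintro W ⟨A, C, rfl⟩
      refine ⟨fun a => if a = x then P' ++ A ++ [s] else if a = y then s :: (C ++ S') else φ a,
        ?_, ?_⟩
      · intro a
        dsimp only
        split_ifs
        · simp
        · simp
        · exact hφ a
      · have e : ∀ Z : List α, x ∉ Z → y ∉ Z → (Z.map (fun a => if a = x then P' ++ A ++ [s] else
            if a = y then s :: (C ++ S') else φ a)).flatten = (Z.map φ).flatten := by
          intro Z h1 h2
          apply map_flatten_congr
          intro a ha
          rw [if_neg (by rintro rfl; exact h1 ha), if_neg (by rintro rfl; exact h2 ha)]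
        rw [hVe]
        simp only [List.map_append, List.map_cons, List.flatten_append, List.flatten_cons]
        rw [e U hxU hyU, e R (by tauto) hyR, e T (by tauto) hyT]
        simp [hyx]
  · push Not at hB
    refine ⟨U, [x], B, by simp [hVe], ?_, ?_, ?_⟩
    · intro a ha
      exact two a (by simp [hVe, ha]) (hU a ha)
    · intro a ha
      exact two a (by simp [hVe, ha]) (hB a ha)
    · rintro P S ⟨φ, hφ, ⟨P', rfl⟩, ⟨S', rfl⟩⟩
      refine ⟨[s], ?_⟩
      rintro W ⟨A, C, rfl⟩
      refine ⟨fun a => if a = x then P' ++ (A ++ [s] ++ C) ++ S' else φ a, ?_, ?_⟩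
      · intro a
        dsimp only
        split_ifs
        · simp
        · exact hφ a
      · have e : ∀ Z : List α, x ∉ Z → (Z.map (fun a => if a = x then P' ++ (A ++ [s] ++ C) ++ S'
            else φ a)).flatten = (Z.map φ).flatten := by
          intro Z h1
          apply map_flatten_congr
          intro a ha
          rw [if_neg (by rintro rfl; exact h1 ha)]
        rw [hVe]
        simp only [List.map_append, List.map_cons, List.flatten_append, List.flatten_cons]
        rw [e U hxU, e B hxB]
        simp

lemma rep_of_long {α σ : Type*} [DecidableEq α] (V : List α) (φ : α → List σ) (a : α)
    (ha : 2 ≤ V.count a) (t : ℕ) (ht : t ≤ (φ a).length) : RepW t (V.map φ).flatten := by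
  have hVa : a ∈ V := List.count_pos_iff.1 (by omega)
  obtain ⟨A, B, rfl, hA⟩ := List.eq_append_cons_of_mem hVa
  have hB : a ∈ B := by
    apply List.count_pos_iff.1
    rw [List.count_append, List.count_eq_zero_of_not_mem hA, List.count_cons_self] at ha
    omega
  obtain ⟨C, D, rfl⟩ := List.append_of_mem hB
  refine ⟨(A.map φ).flatten, (φ a).take t, (φ a).drop t ++ (C.map φ).flatten,
    (φ a).drop t ++ (D.map φ).flatten, by simpa using ht, ?_⟩
  have e : ∀ Z : List σ, (φ a).take t ++ ((φ a).drop t ++ Z) = φ a ++ Z := by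
    intro Z
    rw [← List.append_assoc, List.take_append_drop]
  simp only [List.append_assoc, e]
  simp

lemma short_flatten {α σ : Type*} (U : List α) (φ : α → List σ) (t : ℕ)
    (h : ∀ a ∈ U, (φ a).length ≤ t) : (U.map φ).flatten.length ≤ U.length * t := by
  induction U with
  | nil => simp
  | cons a U ih =>
    have h1 := h a (by simp)
    have h2 := ih fun b hb => h b (by simp [hb])
    simp only [List.map_cons, List.flatten_cons, List.length_append, List.length_cons]
    nlinarith

lemma flatten_inj {α σ : Type*} (φ ψ : α → List σ) (V : List α)
    (hl : ∀ a, (φ a).length = (ψ a).length)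
    (h : (V.map φ).flatten = (V.map ψ).flatten) : ∀ a ∈ V, φ a = ψ a := by
  induction V with
  | nil => simp
  | cons a V ih =>
    simp only [List.map_cons, List.flatten_cons] at h
    obtain ⟨h1, h2⟩ := List.append_inj h (hl a)
    intro b hb
    rcases List.mem_cons.1 hb with rfl | hb
    · exact h1
    · exact ih h2 b hb

lemma lower_bound {α σ : Type*} [DecidableEq α] [Fintype σ] [Nonempty σ] (V : List α)
    (hV : ∃ a ∈ V, V.count a = 1) (n : ℕ) (hn : V.length ≤ n) :
    ((Fintype.card σ : ℝ))⁻¹ ^ (V.length - V.toFinset.card) ≤ instProb V σ n := by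
  classical
  obtain ⟨x, hxV, hx⟩ := hV
  set k := n - V.length + 1 with hk
  have s : σ := Classical.arbitrary σ
  let Φ : ({a : α // a ∈ V.toFinset.erase x} → σ) × (Fin k → σ) → α → List σ :=
    fun p a => if a = x then List.ofFn p.2 else
      if h : a ∈ V.toFinset.erase x then [p.1 ⟨a, h⟩] else [s]
  have hlen : ∀ p a, (Φ p a).length = if a = x then k else 1 := by
    intro p a
    simp only [Φ]
    split_ifs <;> simp [hk]
  have hne : ∀ p a, Φ p a ≠ [] := by
    intro p a h
    have := hlen p a
    rw [h] at this
    split_ifs at this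
  have hL : ∀ p, (V.map (Φ p)).flatten.length = n := by
    intro p
    obtain ⟨A, B, hVe⟩ := List.append_of_mem hxV
    have hx' := hx
    rw [hVe] at hx'
    simp [List.count_append] at hx'
    have one : ∀ Z : List α, x ∉ Z → (Z.map (Φ p)).flatten.length = Z.length := by
      intro Z hZ
      induction Z with
      | nil => simp
      | cons z Z ih =>
        simp only [List.mem_cons, not_or] at hZ
        have h1 := hlen p z
        rw [if_neg (Ne.symm hZ.1)] at h1
        simp only [List.map_cons, List.flatten_cons, List.length_append, List.length_cons,
          h1, ih hZ.2]
        omega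
    have hA := one A (by intro h; have := List.count_pos_iff.2 h; omega)
    have hB := one B (by intro h; have := List.count_pos_iff.2 h; omega)
    have hx1 := hlen p x
    rw [if_pos rfl] at hx1
    have hVl := congrArg List.length hVe
    simp only [List.length_append, List.length_cons] at hVl
    have : (V.map (Φ p)).flatten = (A.map (Φ p)).flatten ++ (Φ p x ++ (B.map (Φ p)).flatten) := by
      rw [hVe]; simp
    rw [this, List.length_append, List.length_append, hA, hB, hx1]
    omega
  let F : ({a : α // a ∈ V.toFinset.erase x} → σ) × (Fin k → σ) →
      {w : Fin n → σ // IsInstance V (List.ofFn w)} := fun p =>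
    ⟨fun i => (V.map (Φ p)).flatten.get (i.cast (hL p).symm), Φ p, hne p, by
      apply List.ext_getElem
      · simp only [List.length_ofFn, hL p]
      · intro i h1 h2
        simp⟩
  have hFl : ∀ p, List.ofFn (F p).1 = (V.map (Φ p)).flatten := by
    intro p
    apply List.ext_getElem
    · simp only [List.length_ofFn, hL p]
    · intro i h1 h2
      simp [F]
  have hF : Function.Injective F := by
    intro p p' h
    have h2 : (V.map (Φ p)).flatten = (V.map (Φ p')).flatten := by
      rw [← hFl, ← hFl, h]
    have h3 := flatten_inj _ _ V (fun a => by rw [hlen, hlen]) h2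
    apply Prod.ext
    · funext ⟨a, ha⟩
      have ha' := Finset.mem_erase.1 ha
      have := h3 a (List.mem_toFinset.1 ha'.2)
      simp only [Φ, if_neg ha'.1, dif_pos ha] at this
      simpa using this
    · have := h3 x hxV
      simp only [Φ, if_true] at this
      exact List.ofFn_injective this
  have hcard := Nat.card_le_card_of_injective F hF
  rw [Nat.card_eq_fintype_card, Fintype.card_prod, Fintype.card_fun, Fintype.card_fun,
    Fintype.card_coe, Fintype.card_fin, ← pow_add,
    Finset.card_erase_of_mem (List.mem_toFinset.2 hxV)] at hcard
  have hd : 0 < V.toFinset.card := Finset.card_pos.2 ⟨x, List.mem_toFinset.2 hxV⟩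
  have hd2 := V.toFinset_card_le
  unfold instProb
  have hq : (0 : ℝ) < Fintype.card σ := by positivity
  rw [le_div_iff₀ (by positivity), inv_pow, inv_mul_le_iff₀ (by positivity)]
  calc (Fintype.card σ : ℝ) ^ n = (Fintype.card σ : ℝ) ^ (V.length - V.toFinset.card) *
        (Fintype.card σ : ℝ) ^ (V.toFinset.card - 1 + k) := by
        rw [← pow_add]; congr 1; omega
    _ ≤ _ := by
        gcongr
        exact_mod_cast hcard

/-- Probability of the boundary condition with boundary words of length `m`. -/
noncomputable def pp {α : Type*} (σ : Type*) [Fintype σ] (U T : List α) (m : ℕ) : ℝ :=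
  EE σ m (fun P => EE σ m (fun S => ind (QQ U T P S)))

section
variable {α σ : Type*} [Fintype σ] [Nonempty σ]

lemma EE_le_one (n : ℕ) {f : List σ → ℝ} (h : ∀ l, f l ≤ 1) : EE σ n f ≤ 1 := by
  rw [← EE_const (σ := σ) n 1]
  exact EE_mono fun l _ => h l

lemma pp_mono (U T : List α) : Monotone (pp σ U T) := by
  apply monotone_nat_of_le_succ
  intro m
  unfold pp
  rw [EE_append m 1]
  apply EE_mono
  intro P _
  conv_lhs => rw [← EE_const (σ := σ) 1 (EE σ m _)]
  apply EE_mono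
  intro P' _
  rw [add_comm m 1, EE_append 1 m]
  conv_lhs => rw [← EE_const (σ := σ) 1 (EE σ m _)]
  apply EE_mono
  intro S' _
  apply EE_mono
  intro S _
  apply ind_mono
  rintro ⟨φ, h1, h2, h3⟩
  exact ⟨φ, h1, h2.trans (List.prefix_append _ _), h3.trans (List.suffix_append _ _)⟩

lemma pp_le_one (U T : List α) (m : ℕ) : pp σ U T m ≤ 1 :=
  EE_le_one m fun _ => EE_le_one m fun _ => ind_le_one _

lemma upper_bound [DecidableEq α] (V U M T : List α) (hVe : V = U ++ (M ++ T))
    (hU : ∀ a ∈ U, 2 ≤ V.count a) (hT : ∀ a ∈ T, 2 ≤ V.count a) (n : ℕ) :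
    instProb V σ n ≤ pp σ U T (n / 2) +
      ((n + 1 : ℕ) : ℝ) * ((n + 1 : ℕ) : ℝ) *
        ((Fintype.card σ : ℝ) ^ (n / 2 / V.length))⁻¹ := by
  rw [instProb_eq]
  refine le_trans ?_ (add_le_add_right (rep_bound n (n / 2 / V.length)) _)
  set t := n / 2 / V.length with ht
  obtain ⟨m, r, hm, hn⟩ : ∃ m r, n / 2 = m ∧ n = m + (r + m) :=
    ⟨n / 2, n % 2, rfl, by omega⟩
  rw [hm] at ht ⊢
  rw [hn]
  have hp : pp σ U T m = EE σ (m + (r + m))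
      (fun l => ind (QQ U T (l.take m) (l.drop (m + r)))) := by
    rw [EE_append]
    unfold pp
    apply EE_congr
    intro P hP
    rw [EE_append]
    rw [← EE_const (σ := σ) r (EE σ m _)]
    apply EE_congr
    intro R hR
    apply EE_congr
    intro S hS
    have h1 : (P ++ (R ++ S)).take m = P := by
      rw [← hP]; simp
    have h2 : (P ++ (R ++ S)).drop (m + r) = S := by
      rw [← hP, ← hR, ← List.append_assoc, ← List.length_append, List.drop_left]
    rw [h1, h2]
  rw [hp, ← EE_add]
  apply EE_mono
  intro l hl
  by_cases hr : RepW t l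
  · rw [ind_true hr]
    linarith [ind_le_one (IsInstance V l), ind_nonneg (QQ U T (l.take m) (l.drop (m + r)))]
  · rw [ind_false hr, add_zero]
    apply ind_mono
    rintro ⟨φ, h1, h2⟩
    have hshort : ∀ Z : List α, Z.length ≤ V.length → (∀ a ∈ Z, 2 ≤ V.count a) →
        (Z.map φ).flatten.length ≤ m := by
      intro Z hZ hZ2
      refine (short_flatten Z φ t ?_).trans ?_
      · intro a ha
        by_contra hc
        apply hr
        rw [h2]
        exact rep_of_long V φ a (hZ2 a ha) t (by omega)
      · calc Z.length * t ≤ V.length * t := by gcongr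
          _ ≤ m := by rw [ht]; exact Nat.mul_div_le _ _
    have hlen := congrArg List.length hVe
    simp only [List.length_append] at hlen
    have hl2 : l = (U.map φ).flatten ++ ((M.map φ).flatten ++ (T.map φ).flatten) := by
      rw [h2, hVe]; simp
    refine ⟨φ, h1, ?_, ?_⟩
    · apply List.prefix_of_prefix_length_le (l₃ := l)
      · rw [hl2]; exact List.prefix_append _ _
      · exact List.take_prefix _ _
      · rw [List.length_take, hl]
        have := hshort U (by omega) hU
        omega
    · apply List.suffix_of_suffix_length_le (l₃ := l)
      · rw [hl2, ← List.append_assoc]; exact List.suffix_append _ _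
      · exact List.drop_suffix _ _
      · rw [List.length_drop, hl]
        have := hshort T (by omega) hT
        omega

lemma lower_lim (V U T : List α)
    (h : ∀ P S : List σ, QQ U T P S → ∃ Y : List σ, ∀ W, Y <:+: W → IsInstance V (P ++ (W ++ S)))
    (m : ℕ) (ε : ℝ) (hε : 0 < ε) : ∀ᶠ n in atTop, pp σ U T m - ε ≤ instProb V σ n := by
  have key : ∀ P S : List σ, ∀ᶠ N in atTop,
      ind (QQ U T P S) ≤ EE σ N (fun W => ind (IsInstance V (P ++ (W ++ S)))) + ε := by
    intro P S
    by_cases hQ : QQ U T P S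
    · obtain ⟨Y, hY⟩ := h P S hQ
      filter_upwards [(infix_tendsto Y).eventually (gt_mem_nhds hε)] with N hN
      rw [ind_true hQ]
      have h1 : (1 : ℝ) ≤ EE σ N (fun W => ind (IsInstance V (P ++ (W ++ S))) +
          ind (¬ Y <:+: W)) := by
        rw [← EE_const (σ := σ) N 1]
        apply EE_mono
        intro W _
        by_cases hW : Y <:+: W
        · rw [ind_true (hY W hW)]; linarith [ind_nonneg (¬ Y <:+: W)]
        · rw [ind_true hW]; linarith [ind_nonneg (IsInstance V (P ++ (W ++ S)))]
      rw [EE_add] at h1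
      linarith
    · refine Eventually.of_forall fun N => ?_
      rw [ind_false hQ]
      have := EE_nonneg (σ := σ) N (f := fun W => ind (IsInstance V (P ++ (W ++ S))))
        fun l => ind_nonneg _
      linarith
  have key2 : ∀ᶠ N in atTop, ∀ P S : Fin m → σ, ind (QQ U T (List.ofFn P) (List.ofFn S)) ≤
      EE σ N (fun W => ind (IsInstance V (List.ofFn P ++ (W ++ List.ofFn S)))) + ε := by
    simp only [eventually_all]
    exact fun P S => key _ _
  obtain ⟨N0, hN0⟩ := eventually_atTop.1 key2
  filter_upwards [eventually_ge_atTop (N0 + 2 * m)] with n hn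
  obtain ⟨N, rfl⟩ : ∃ N, n = m + (N + m) := ⟨n - 2 * m, by omega⟩
  have hN := hN0 N (by omega)
  have ofl : ∀ l : List σ, l.length = m → ∃ w : Fin m → σ, l = List.ofFn w := by
    rintro l rfl
    exact ⟨l.get, (List.ofFn_get l).symm⟩
  rw [instProb_eq, sub_le_iff_le_add, EE_append]
  unfold pp
  conv_rhs => rw [← EE_const (σ := σ) m ε]
  rw [← EE_add]
  apply EE_mono
  intro P hP
  have hsw : EE σ (N + m) (fun v => ind (IsInstance V (P ++ v))) =
      EE σ m (fun S => EE σ N (fun W => ind (IsInstance V (P ++ (W ++ S))))) := by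
    rw [EE_append]
    unfold EE
    rw [← Finset.sum_div, ← Finset.sum_div, Finset.sum_comm, div_div, div_div, mul_comm]
  rw [hsw]
  conv_rhs => rw [← EE_const (σ := σ) m ε]
  rw [← EE_add]
  apply EE_mono
  intro S hS
  obtain ⟨P, rfl⟩ := ofl P hP
  obtain ⟨S, rfl⟩ := ofl S hS
  exact hN P S

end

lemma err_tendsto (q : ℝ) (hq : 1 < q) (k : ℕ) (hk : 0 < k) :
    Tendsto (fun n : ℕ => ((n + 1 : ℕ) : ℝ) * ((n + 1 : ℕ) : ℝ) * (q ^ (n / 2 / k))⁻¹)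
      atTop (nhds 0) := by
  have h1 : Tendsto (fun t : ℕ => (t : ℝ) ^ 2 / q ^ t) atTop (nhds 0) :=
    tendsto_pow_const_div_const_pow_of_one_lt 2 hq
  have h2 : Tendsto (fun n : ℕ => n / 2 / k + 1) atTop atTop := by
    refine (tendsto_add_atTop_nat 1).comp ?_
    exact (Nat.tendsto_div_const_atTop hk.ne').comp (Nat.tendsto_div_const_atTop two_ne_zero)
  have h3 := ((h1.comp h2).const_mul ((2 * k : ℝ) ^ 2 * q))
  rw [mul_zero] at h3
  refine squeeze_zero (fun n => by positivity) (fun n => ?_) h3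
  have hq0 : 0 < q := by linarith
  set t := n / 2 / k with ht
  have hb : n + 1 ≤ 2 * k * (t + 1) := by
    have e1 : n / 2 < k * (t + 1) := by
      rw [ht]; exact Nat.lt_mul_div_succ _ hk
    nlinarith [Nat.div_add_mod n 2, Nat.mod_lt n two_pos]
  have hb' : ((n + 1 : ℕ) : ℝ) ≤ 2 * k * ((t + 1 : ℕ) : ℝ) := by exact_mod_cast hb
  calc ((n + 1 : ℕ) : ℝ) * ((n + 1 : ℕ) : ℝ) * (q ^ t)⁻¹
      ≤ (2 * k * ((t + 1 : ℕ) : ℝ)) * (2 * k * ((t + 1 : ℕ) : ℝ)) * (q ^ t)⁻¹ := by gcongr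
    _ = _ := by
      simp only [Function.comp]
      rw [← ht]
      field_simp
      ring

/-- For nondoubled `V` and a finite nonempty alphabet `Σ` with `q` letters, the
limit `I(V,Σ) = lim_n I_n(V,Σ)` exists, and `I(V,Σ) ≥ q^{-‖V‖} > 0`, where
`‖V‖ = |V| - #distinct letters of V`. -/
theorem stmt10 {α σ : Type*} [DecidableEq α] [Fintype σ] [Nonempty σ] (V : List α)
    (hV : ∃ a ∈ V, V.count a = 1) :
    ∃ L : ℝ, Tendsto (fun n => instProb V σ n) atTop (nhds L) ∧
      ((Fintype.card σ : ℝ))⁻¹ ^ (V.length - V.toFinset.card) ≤ L ∧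
      0 < ((Fintype.card σ : ℝ))⁻¹ ^ (V.length - V.toFinset.card) := by
  classical
  have hqpos : 0 < Fintype.card σ := Fintype.card_pos
  have hpos : 0 < ((Fintype.card σ : ℝ))⁻¹ ^ (V.length - V.toFinset.card) := by positivity
  have hlow : ∀ᶠ n in atTop, ((Fintype.card σ : ℝ))⁻¹ ^ (V.length - V.toFinset.card) ≤
      instProb V σ n := by
    filter_upwards [eventually_ge_atTop V.length] with n hn
    exact lower_bound V hV n hn
  suffices hs : ∃ L : ℝ, Tendsto (fun n => instProb V σ n) atTop (nhds L) by
    obtain ⟨L, hL⟩ := hs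
    exact ⟨L, hL, ge_of_tendsto hL hlow, hpos⟩
  by_cases hq : Fintype.card σ = 1
  · refine ⟨1, tendsto_const_nhds.congr' ?_⟩
    filter_upwards [hlow] with n hn
    apply le_antisymm
    · simpa [hq] using hn
    · rw [instProb_eq]
      exact EE_le_one n fun _ => ind_le_one _
  obtain ⟨U, M, T, hVe, hU, hT, hI⟩ := decomp σ V hV
  have hVl : 0 < V.length := by
    obtain ⟨a, ha, _⟩ := hV
    exact List.length_pos_of_mem ha
  have hbdd : BddAbove (Set.range (pp σ U T)) := ⟨1, by rintro _ ⟨m, rfl⟩; exact pp_le_one U T m⟩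
  have hlim := tendsto_atTop_ciSup (pp_mono (σ := σ) U T) hbdd
  set L := ⨆ i, pp σ U T i
  refine ⟨L, tendsto_order.2 ⟨fun a ha => ?_, fun b hb => ?_⟩⟩
  · obtain ⟨m, hm⟩ := (hlim.eventually (lt_mem_nhds ha)).exists
    filter_upwards [lower_lim V U T hI m ((pp σ U T m - a) / 2) (by linarith)] with n hn
    linarith
  · have herr := err_tendsto (Fintype.card σ : ℝ) (by
      have : 1 < Fintype.card σ := by omega
      exact_mod_cast this) V.length hVl
    filter_upwards [herr.eventually (gt_mem_nhds (sub_pos.2 hb))] with n hn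
    have h1 := upper_bound (σ := σ) V U M T hVe hU hT n
    have h2 : pp σ U T (n / 2) ≤ L := le_ciSup hbdd _
    linarith
end

section
/- Let V be a nondoubled word, Σ a finite nonempty alphabet, and W_n ∈ Σ^n chosen uniformly at random. Then lim_{n→∞} E(δ(V,W_n)) exists and equals I(V,Σ) = lim_{n→∞} I_n(V,Σ). -/
open Filter Asymptotics

open Classical in
/-- Number of words of length `n` satisfying a predicate. -/
noncomputable def cntW (σ : Type*) [Fintype σ] (n : ℕ) (R : List σ → Prop) : ℕ :=
  (Finset.univ.filter (fun w : Fin n → σ => R (List.ofFn w))).card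

lemma instProb_eq_s11 {α σ : Type*} [Fintype σ] (V : List α) (n : ℕ) :
    instProb V σ n = (cntW σ n (IsInstance V) : ℝ) / (Fintype.card σ : ℝ) ^ n := by
  classical
  unfold instProb cntW
  rw [Nat.card_eq_fintype_card, Fintype.card_subtype]

lemma cntW_le {σ : Type*} [Fintype σ] (n : ℕ) (R : List σ → Prop) :
    cntW σ n R ≤ Fintype.card σ ^ n := by
  classical
  unfold cntW
  refine (Finset.card_le_univ _).trans ?_
  simp

/-- `m` is a good place for insertions. -/
def GoodAt {α σ : Type*} (V : List α) (m : ℕ) (w : List σ) : Prop :=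
  ∀ u : List σ, IsInstance V (w.take m ++ u ++ w.drop m)

def RepAt {σ : Type*} (l i j : ℕ) (w : List σ) : Prop :=
  (w.drop i).take l = (w.drop j).take l

def HasRep {σ : Type*} (l : ℕ) (w : List σ) : Prop :=
  ∃ i j, i < j ∧ j + l ≤ w.length ∧ RepAt l i j w

lemma cntW_ins {α σ : Type*} [Fintype σ] (V : List α) {m n N : ℕ} (hm : m ≤ n) (hN : n ≤ N) :
    cntW σ n (GoodAt V m) * Fintype.card σ ^ (N - n) ≤ cntW σ N (IsInstance V) := by
  classical
  obtain ⟨r, rfl⟩ : ∃ r, n = m + r := ⟨n - m, by omega⟩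
  obtain ⟨k, rfl⟩ : ∃ k, N = m + k + r := ⟨N - (m + r), by omega⟩
  have hk : m + k + r - (m + r) = k := by omega
  rw [hk]
  have hc : Fintype.card σ ^ k = (Finset.univ : Finset (Fin k → σ)).card := by simp
  rw [hc]
  unfold cntW
  rw [← Finset.card_product]
  refine Finset.card_le_card_of_injOn
    (fun p => Fin.append (Fin.append (fun i => p.1 (Fin.castAdd r i)) p.2)
      (fun i => p.1 (Fin.natAdd m i))) ?_ ?_
  · rintro ⟨w, u⟩ h
    simp only [Finset.coe_product, Finset.coe_filter, Finset.mem_univ, true_and, Finset.coe_univ,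
      Set.mem_prod, Set.mem_ofPred_eq, Set.mem_univ, and_true] at h ⊢
    have h2 := h (List.ofFn u)
    obtain ⟨⟨a, b⟩, rfl⟩ := (Fin.appendEquiv m r).surjective w
    simp only [Fin.appendEquiv, Equiv.coe_fn_mk, List.ofFn_fin_append] at h2 ⊢
    simp only [Fin.append_left, Fin.append_right]
    rw [List.take_left' (by simp), List.drop_left' (by simp)] at h2
    exact h2
  · rintro ⟨w, u⟩ - ⟨w', u'⟩ - h
    have h' := fun x => congrFun h x
    simp only at h'
    have h1 : w = w' := by
      funext x
      refine Fin.addCases (fun i => ?_) (fun i => ?_) x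
      · simpa using h' (Fin.castAdd r (Fin.castAdd k i))
      · simpa using h' (Fin.natAdd (m + k) i)
    have h2 : u = u' := by
      funext i
      simpa using h' (Fin.castAdd r (Fin.natAdd m i))
    rw [h1, h2]

lemma cntW_rep {σ : Type*} [Fintype σ] {l i j n : ℕ} (hij : i < j) (hj : j + l ≤ n) :
    cntW σ n (RepAt l i j) * Fintype.card σ ^ l ≤ Fintype.card σ ^ n := by
  classical
  have hc : ∀ k, Fintype.card σ ^ k = (Finset.univ : Finset (Fin k → σ)).card := by simp
  rw [hc, hc]
  unfold cntW
  rw [← Finset.card_product]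
  refine Finset.card_le_card_of_injOn
    (fun p => fun k : Fin n => if h : j ≤ k.1 ∧ k.1 < j + l then p.2 ⟨k.1 - j, by omega⟩ else p.1 k)
    (fun _ _ => by simp) ?_
  rintro ⟨w, u⟩ hw ⟨w', u'⟩ hw' h
  have h' := fun x => congrFun h x
  simp only at h'
  simp only [Finset.coe_product, Finset.coe_filter, Finset.mem_univ, true_and, Finset.coe_univ,
      Set.mem_prod, Set.mem_ofPred_eq, Set.mem_univ, and_true] at hw hw'
  unfold RepAt at hw hw'
  have key : ∀ v : Fin n → σ,
      List.take l (List.drop i (List.ofFn v)) = List.take l (List.drop j (List.ofFn v)) →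
      ∀ t (ht : t < l), v ⟨j + t, by omega⟩ = v ⟨i + t, by omega⟩ := by
    intro v hv t ht
    have := congrArg (fun L => L[t]?) hv
    simp only [List.getElem?_take, ht, if_true, List.getElem?_drop, List.getElem?_ofFn] at this
    rw [dif_pos (by omega), dif_pos (by omega)] at this
    exact (Option.some.inj this).symm
  have h2 : u = u' := by
    funext t
    have := h' ⟨j + t.1, by omega⟩
    simpa using this
  have h1 : ∀ k (hk : k < n), w ⟨k, hk⟩ = w' ⟨k, hk⟩ := by
    intro k
    induction k using Nat.strong_induction_on with
    | _ k ih =>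
      intro hk
      by_cases hb : j ≤ k ∧ k < j + l
      · obtain ⟨t, rfl⟩ : ∃ t, k = j + t := ⟨k - j, by omega⟩
        rw [key w hw t (by omega), key w' hw' t (by omega)]
        exact ih _ (by omega) _
      · have := h' ⟨k, hk⟩
        simpa [hb] using this
  rw [h2, show w = w' from funext fun k => h1 k.1 k.2]

lemma rep_of_eq {σ : Type*} {l : ℕ} (A x B C : List σ) (hx : x ≠ []) (hl : l ≤ x.length) :
    HasRep l (A ++ (x ++ (B ++ (x ++ C)))) := by
  have hp : 0 < x.length := List.length_pos_iff.2 hx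
  refine ⟨A.length, A.length + x.length + B.length, by omega, by simp; omega, ?_⟩
  unfold RepAt
  rw [List.drop_left' rfl,
    show A ++ (x ++ (B ++ (x ++ C))) = (A ++ x ++ B) ++ (x ++ C) by simp,
    List.drop_left' (by simp; omega), List.take_append_of_le_length hl,
    List.take_append_of_le_length hl]

lemma split_flat {α σ : Type*} (φ : α → List σ) (V : List α) :
    ∀ m < ((V.map φ).flatten).length, ∃ U a U', V = U ++ a :: U' ∧
      ((U.map φ).flatten).length ≤ m ∧ m < ((U.map φ).flatten).length + (φ a).length := by
  induction V with
  | nil => intro m hm; simp at hm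
  | cons b V ih =>
    intro m hm
    by_cases h : m < (φ b).length
    · exact ⟨[], b, V, rfl, by simp, by simpa using h⟩
    · simp only [List.map_cons, List.flatten_cons, List.length_append] at hm
      obtain ⟨U, a, U', rfl, h1, h2⟩ := ih (m - (φ b).length) (by omega)
      refine ⟨b :: U, a, U', rfl, ?_, ?_⟩ <;>
        simp only [List.map_cons, List.flatten_cons, List.length_append] <;> omega

lemma good_of_nonce {α σ : Type*} [DecidableEq α] (φ : α → List σ) (hφ : ∀ a, φ a ≠ [])
    (U U' : List α) (a : α) (hU : a ∉ U) (hU' : a ∉ U') (m : ℕ)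
    (h1 : ((U.map φ).flatten).length ≤ m)
    (h2 : m < ((U.map φ).flatten).length + (φ a).length) :
    GoodAt (U ++ a :: U') m (((U ++ a :: U').map φ).flatten) := by
  intro u
  set s := ((U.map φ).flatten).length with hs
  refine ⟨Function.update φ a ((φ a).take (m - s) ++ u ++ (φ a).drop (m - s)), ?_, ?_⟩
  · intro b
    by_cases hb : b = a
    · subst hb
      simp only [Function.update_self, ne_eq, List.append_eq_nil_iff, List.drop_eq_nil_iff]
      omega
    · simpa [Function.update_of_ne hb] using hφ b
  · have e : ∀ L : List α, a ∉ L → ∀ y, L.map (Function.update φ a y) = L.map φ := by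
      intro L hL y
      refine List.map_congr_left fun b hb => Function.update_of_ne ?_ _ _
      rintro rfl; exact hL hb
    simp only [List.map_append, List.map_cons, e U hU, e U' hU', Function.update_self,
      List.flatten_append, List.flatten_cons]
    obtain ⟨t, rfl⟩ : ∃ t, m = s + t := ⟨m - s, by omega⟩
    have ht : t ≤ (φ a).length := by omega
    rw [hs, List.take_length_add_append, List.drop_length_add_append, ← hs,
      List.take_append_of_le_length ht, List.drop_append_of_le_length ht]
    simp

open Classical in
lemma bad_card {α σ : Type*} [DecidableEq α] (V : List α) (w : List σ) (l : ℕ)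
    (h : IsInstance V w) (hr : ¬ HasRep l w) :
    ((Finset.range w.length).filter (fun m => ¬ GoodAt V m w)).card ≤ V.length * l := by
  obtain ⟨φ, hφ, rfl⟩ := h
  have hsub : ((Finset.range ((V.map φ).flatten).length).filter
      (fun m => ¬ GoodAt V m ((V.map φ).flatten))) ⊆
      (Finset.range V.length ×ˢ Finset.range l).image
        (fun p => (((V.take p.1).map φ).flatten).length + p.2) := by
    intro m hm
    rw [Finset.mem_filter, Finset.mem_range] at hm
    obtain ⟨hm, hb⟩ := hm
    obtain ⟨U, a, U', rfl, h1, h2⟩ := split_flat φ V m hm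
    have hl : (φ a).length < l := by
      by_contra hl
      push Not at hl
      by_cases hU : a ∈ U
      · obtain ⟨A, B, rfl⟩ := List.append_of_mem hU
        apply hr
        simpa using rep_of_eq (A.map φ).flatten (φ a) (B.map φ).flatten (U'.map φ).flatten (hφ a) hl
      · by_cases hU' : a ∈ U'
        · obtain ⟨A, B, rfl⟩ := List.append_of_mem hU'
          apply hr
          simpa using
            rep_of_eq (U.map φ).flatten (φ a) (A.map φ).flatten (B.map φ).flatten (hφ a) hl
        · exact hb (good_of_nonce φ hφ U U' a hU hU' m h1 h2)
    rw [Finset.mem_image]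
    refine ⟨(U.length, m - ((U.map φ).flatten).length), ?_, ?_⟩
    · simp only [Finset.mem_product, Finset.mem_range, List.length_append, List.length_cons]
      omega
    · simp only [List.take_left']
      omega
  refine (Finset.card_le_card hsub).trans (Finset.card_image_le.trans ?_)
  simp

lemma cntW_hasRep {σ : Type*} [Fintype σ] {l n : ℕ} (hl : 1 ≤ l) :
    cntW σ n (HasRep l) * Fintype.card σ ^ l ≤ n ^ 2 * Fintype.card σ ^ n := by
  classical
  have h1 : cntW σ n (HasRep l) ≤ ∑ p ∈ ((Finset.range n ×ˢ Finset.range n).filter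
      (fun p : ℕ × ℕ => p.1 < p.2 ∧ p.2 + l ≤ n)), cntW σ n (RepAt l p.1 p.2) := by
    unfold cntW
    refine le_trans (Finset.card_le_card ?_) Finset.card_biUnion_le
    intro w hw
    rw [Finset.mem_filter] at hw
    obtain ⟨-, i, j, hij, hj, h⟩ := hw
    rw [List.length_ofFn] at hj
    rw [Finset.mem_biUnion]
    refine ⟨(i, j), ?_, by simpa using h⟩
    simp only [Finset.mem_filter, Finset.mem_product, Finset.mem_range]
    omega
  refine (Nat.mul_le_mul_right _ h1).trans ?_
  rw [Finset.sum_mul]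
  refine (Finset.sum_le_card_nsmul _ _ (Fintype.card σ ^ n) ?_).trans ?_
  · intro p hp
    rw [Finset.mem_filter] at hp
    exact cntW_rep hp.2.1 hp.2.2
  · rw [smul_eq_mul]
    refine Nat.mul_le_mul_right _ ((Finset.card_filter_le _ _).trans ?_)
    simp [sq]

lemma main_count {α σ : Type*} [DecidableEq α] [Fintype σ] (V : List α) (l n : ℕ) :
    n * cntW σ n (IsInstance V) ≤ (∑ m ∈ Finset.range n, cntW σ n (GoodAt V m))
      + n * cntW σ n (HasRep l) + V.length * l * Fintype.card σ ^ n := by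
  classical
  have hc : Fintype.card σ ^ n = ∑ w : Fin n → σ, 1 := by simp
  unfold cntW
  simp only [Finset.card_filter, hc]
  rw [Finset.sum_comm, Finset.mul_sum, Finset.mul_sum, Finset.mul_sum, ← Finset.sum_add_distrib,
    ← Finset.sum_add_distrib]
  refine Finset.sum_le_sum fun w _ => ?_
  by_cases hI : IsInstance V (List.ofFn w)
  · by_cases hR : HasRep l (List.ofFn w)
    · simp only [hI, hR, if_true]; omega
    · have hb := bad_card V (List.ofFn w) l hI hR
      rw [List.length_ofFn] at hb
      have hs := Finset.card_filter_add_card_filter_not (s := Finset.range n)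
        (fun m => GoodAt V m (List.ofFn w))
      rw [Finset.card_range] at hs
      rw [← Finset.card_filter]
      simp only [hI, hR, if_true, if_false]
      omega
  · simp [hI]

lemma almost_mono {α σ : Type*} [DecidableEq α] [Fintype σ] [Nonempty σ] (V : List α)
    {l n N : ℕ} (hl : 1 ≤ l) (hn : 1 ≤ n) (hN : n ≤ N) :
    instProb V σ n ≤ instProb V σ N +
      ((n : ℝ) ^ 2 / (Fintype.card σ : ℝ) ^ l + V.length * l / n) := by
  have hq : (0 : ℝ) < Fintype.card σ := by exact_mod_cast Fintype.card_pos
  have h0 := main_count (σ := σ) V l n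
  have h1 : ∀ m ∈ Finset.range n,
      (cntW σ n (GoodAt V m) : ℝ) ≤ instProb V σ N * (Fintype.card σ : ℝ) ^ n := by
    intro m hm
    have := cntW_ins (σ := σ) V (Finset.mem_range.1 hm).le hN
    have h : (cntW σ n (GoodAt V m) : ℝ) * (Fintype.card σ : ℝ) ^ (N - n) ≤
      cntW σ N (IsInstance V) := by exact_mod_cast this
    have hp : (Fintype.card σ : ℝ) ^ N
        = (Fintype.card σ : ℝ) ^ n * (Fintype.card σ : ℝ) ^ (N - n) := by
      rw [← pow_add]; congr 1; omega
    rw [instProb_eq_s11, hp, div_mul_eq_mul_div, le_div_iff₀ (by positivity)]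
    have := mul_le_mul_of_nonneg_right h (pow_pos hq n).le
    linarith
  have h2 : (cntW σ n (HasRep l) : ℝ) ≤
      (n : ℝ) ^ 2 / (Fintype.card σ : ℝ) ^ l * (Fintype.card σ : ℝ) ^ n := by
    have h : (cntW σ n (HasRep l) : ℝ) * (Fintype.card σ : ℝ) ^ l ≤
      (n : ℝ) ^ 2 * (Fintype.card σ : ℝ) ^ n := by exact_mod_cast cntW_hasRep (σ := σ) hl
    rw [div_mul_eq_mul_div, le_div_iff₀ (by positivity)]
    exact h
  have h3 := Finset.sum_le_card_nsmul _ _ _ h1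
  rw [Finset.card_range, nsmul_eq_mul] at h3
  have hn' : (0 : ℝ) < n := by exact_mod_cast hn
  have h4 : (n : ℝ) * cntW σ n (IsInstance V) ≤
      (∑ m ∈ Finset.range n, (cntW σ n (GoodAt V m) : ℝ))
      + n * cntW σ n (HasRep l) + V.length * l * (Fintype.card σ : ℝ) ^ n := by exact_mod_cast h0
  have h5 := mul_le_mul_of_nonneg_left h2 hn'.le
  rw [instProb_eq_s11 (n := n), div_le_iff₀ (by positivity)]
  refine le_of_mul_le_mul_left ?_ hn'
  have h6 : (n : ℝ) * (V.length * l / n) = V.length * l := by field_simp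
  calc _ ≤ _ := h4
    _ ≤ n * (instProb V σ N * (Fintype.card σ : ℝ) ^ n) +
        n * ((n : ℝ) ^ 2 / (Fintype.card σ : ℝ) ^ l * (Fintype.card σ : ℝ) ^ n) +
        (n * (V.length * l / n)) * (Fintype.card σ : ℝ) ^ n := by rw [h6]; linarith
    _ = _ := by ring

lemma instProb_le_one {α σ : Type*} [Fintype σ] [Nonempty σ] (V : List α) (n : ℕ) :
    instProb V σ n ≤ 1 := by
  have hq : (0 : ℝ) < Fintype.card σ := by exact_mod_cast Fintype.card_pos
  rw [instProb_eq_s11, div_le_one (by positivity)]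
  exact_mod_cast cntW_le n _

lemma conv_of_almost_mono (a e : ℕ → ℝ) (ha : ∀ n, a n ≤ 1) (he0 : ∀ n, 0 ≤ e n)
    (he : Tendsto e atTop (nhds 0)) (h : ∀ n N, 1 ≤ n → n ≤ N → a n ≤ a N + e n) :
    ∃ L, Tendsto a atTop (nhds L) := by
  let S : Set ℝ := {x | ∃ n, 1 ≤ n ∧ x = a n - e n}
  have hS : BddAbove S := ⟨1, by rintro x ⟨n, -, rfl⟩; linarith [ha n, he0 n]⟩
  have hne : S.Nonempty := ⟨_, 1, le_rfl, rfl⟩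
  refine ⟨sSup S, ?_⟩
  rw [Metric.tendsto_atTop] at he ⊢
  intro d hd
  obtain ⟨_, ⟨n0, hn0, rfl⟩, hx⟩ := exists_lt_of_lt_csSup hne (sub_lt_self (sSup S) hd)
  obtain ⟨n1, hn1⟩ := he d hd
  refine ⟨max n0 n1, fun N hN => ?_⟩
  have h1 := h n0 N hn0 (le_of_max_le_left hN)
  have h2 := hn1 N (le_of_max_le_right hN)
  have h3 : a N - e N ≤ sSup S := le_csSup hS ⟨N, hn0.trans (le_of_max_le_left hN), rfl⟩
  rw [Real.dist_eq, sub_zero, abs_lt] at h2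
  rw [Real.dist_eq, abs_lt]
  constructor <;> linarith

lemma eps_tendsto (q : ℝ) (hq : 2 ≤ q) (c : ℝ) (hc : 0 ≤ c) :
    Tendsto (fun n : ℕ => (n : ℝ) ^ 2 / q ^ (Nat.sqrt n) + c * (Nat.sqrt n) / n) atTop
      (nhds 0) := by
  have hs : Tendsto Nat.sqrt atTop atTop :=
    tendsto_atTop_atTop.2 fun b => ⟨b * b, fun n hn => Nat.le_sqrt.2 hn⟩
  have h1 : Tendsto (fun l : ℕ => q * (((l + 1 : ℕ) : ℝ) ^ 4 / q ^ (l + 1)) + c / l) atTop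
      (nhds (q * 0 + 0)) :=
    ((((tendsto_pow_const_div_const_pow_of_one_lt 4 (r := q) (by linarith)).comp
      (tendsto_add_atTop_nat 1))).const_mul q).add (tendsto_const_div_atTop_nhds_zero_nat c)
  rw [mul_zero, add_zero] at h1
  refine squeeze_zero' (Eventually.of_forall fun n => by positivity) ?_ (h1.comp hs)
  filter_upwards [eventually_ge_atTop 1] with n hn
  have hl : 1 ≤ Nat.sqrt n := Nat.le_sqrt.2 (by simpa using hn)
  have hlo : ((Nat.sqrt n : ℕ) : ℝ) * Nat.sqrt n ≤ n := by exact_mod_cast Nat.sqrt_le n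
  have hhi : (n : ℝ) ≤ ((Nat.sqrt n + 1 : ℕ) : ℝ) ^ 2 := by
    rw [sq]; exact_mod_cast (Nat.lt_succ_sqrt n).le
  have hlr : (1 : ℝ) ≤ (Nat.sqrt n : ℕ) := by exact_mod_cast hl
  simp only [Function.comp]
  refine add_le_add ?_ ?_
  · rw [pow_succ q, ← mul_div_assoc, mul_comm q,
      mul_div_mul_right _ _ (by positivity : q ≠ 0)]
    gcongr
    calc (n : ℝ) ^ 2 ≤ (((Nat.sqrt n + 1 : ℕ) : ℝ) ^ 2) ^ 2 := by gcongr
      _ = _ := by ring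
  · rw [div_le_div_iff₀ (by exact_mod_cast hn) (by linarith)]
    nlinarith

lemma instProb_one {α σ : Type*} [DecidableEq α] [Fintype σ] [Nonempty σ] (V : List α)
    (hV : ∃ a ∈ V, V.count a = 1) (h1 : Fintype.card σ = 1) (n : ℕ) (hn : V.length ≤ n) :
    instProb V σ n = 1 := by
  classical
  obtain ⟨a, ha, hc⟩ := hV
  obtain ⟨c, hcu⟩ := Fintype.card_eq_one_iff.1 h1
  have key : ∀ w : Fin n → σ, IsInstance V (List.ofFn w) := by
    intro w
    have hrep : ∀ L L' : List σ, L.length = L'.length → L = L' := by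
      intro L L' h
      rw [List.eq_replicate_of_mem (a := c) (l := L) fun b _ => hcu b,
        List.eq_replicate_of_mem (a := c) (l := L') fun b _ => hcu b, h]
    refine ⟨Function.update (fun _ => [c]) a (List.replicate (n - V.length + 1) c), ?_, ?_⟩
    · intro b
      by_cases hb : b = a
      · subst hb; simp
      · simp [Function.update_of_ne hb]
    · apply hrep
      obtain ⟨U, U', rfl⟩ := List.append_of_mem ha
      have hU : a ∉ U := by
        intro h; have := List.count_pos_iff.2 h; simp at hc; omega
      have hU' : a ∉ U' := by
        intro h; have := List.count_pos_iff.2 h; simp at hc; omega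
      have e : ∀ L : List α, a ∉ L → ∀ y, L.map (Function.update (fun _ => [c]) a y)
          = L.map (fun _ => [c]) := by
        intro L hL y
        refine List.map_congr_left fun b hb => Function.update_of_ne ?_ _ _
        rintro rfl; exact hL hb
      simp only [List.map_append, List.map_cons, e U hU, e U' hU', Function.update_self,
        List.flatten_append, List.flatten_cons]
      simp at hn ⊢
      omega
  rw [instProb_eq_s11]
  unfold cntW
  simp [key, h1]

lemma instProb_conv {α σ : Type*} [DecidableEq α] [Fintype σ] [Nonempty σ] (V : List α)
    (hV : ∃ a ∈ V, V.count a = 1) : ∃ L : ℝ, Tendsto (fun n => instProb V σ n) atTop (nhds L) := by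
  by_cases h1 : Fintype.card σ = 1
  · refine ⟨1, tendsto_const_nhds.congr' ?_⟩
    filter_upwards [eventually_ge_atTop V.length] with n hn
    exact (instProb_one V hV h1 n hn).symm
  · have h2 : 2 ≤ Fintype.card σ := by
      have := Fintype.card_pos (α := σ); omega
    refine conv_of_almost_mono _ _ (instProb_le_one V) (fun n => ?_)
      (eps_tendsto (Fintype.card σ) (by exact_mod_cast h2) V.length (by positivity)) ?_
    · positivity
    · intro n N hn hN
      exact almost_mono V (Nat.le_sqrt.2 (by simpa using hn)) hn hN

lemma cntW_sub {α σ : Type*} [Fintype σ] (V : List α) {i j n : ℕ} (hij : i < j) (hj : j ≤ n) :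
    cntW σ n (fun w => IsInstance V (subword w i j)) =
      cntW σ (j - i) (IsInstance V) * Fintype.card σ ^ (n - (j - i)) := by
  classical
  obtain ⟨k, rfl⟩ : ∃ k, j = i + k := ⟨j - i, by omega⟩
  obtain ⟨r, rfl⟩ : ∃ r, n = i + k + r := ⟨n - (i + k), by omega⟩
  rw [show i + k + r - (i + k - i) = i + r by omega, show i + k - i = k by omega]
  have hc : Fintype.card σ ^ (i + r) = ((Finset.univ : Finset (Fin i → σ)) ×ˢ
    (Finset.univ : Finset (Fin r → σ))).card := by simp [pow_add]
  rw [hc]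
  unfold cntW
  rw [← Finset.card_product]
  have hsub : ∀ (a : Fin i → σ) (b : Fin k → σ) (c : Fin r → σ),
      subword (List.ofFn (Fin.append (Fin.append a b) c)) i (i + k) = List.ofFn b := by
    intro a b c
    unfold subword
    rw [List.ofFn_fin_append, List.ofFn_fin_append, List.append_assoc,
      List.drop_left' (by simp), List.take_left' (by simp)]
  symm
  refine Finset.card_bij (fun p _ => Fin.append (Fin.append p.2.1 p.1) p.2.2) ?_ ?_ ?_
  · rintro ⟨b, a, c⟩ h
    rw [Finset.mem_product, Finset.mem_filter] at h
    rw [Finset.mem_filter]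
    refine ⟨Finset.mem_univ _, ?_⟩
    beta_reduce; rw [hsub]
    exact h.1.2
  · rintro ⟨b, a, c⟩ - ⟨b', a', c'⟩ - h
    have h1 : (Fin.append a b, c) = (Fin.append a' b', c') :=
      (Fin.appendEquiv (i + k) r).injective h
    rw [Prod.mk.injEq] at h1
    have h2 : (a, b) = (a', b') := (Fin.appendEquiv i k).injective h1.1
    rw [Prod.mk.injEq] at h2
    simp [h1.2, h2.1, h2.2]
  · intro w hw
    obtain ⟨⟨d, c⟩, rfl⟩ := (Fin.appendEquiv (i + k) r).surjective w
    obtain ⟨⟨a, b⟩, rfl⟩ := (Fin.appendEquiv i k).surjective d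
    refine ⟨(b, a, c), ?_, rfl⟩
    rw [Finset.mem_filter] at hw
    have h := hw.2
    simp only [Fin.appendEquiv, Equiv.coe_fn_mk] at h
    rw [hsub] at h
    simpa using h

lemma expDensity_eq {α σ : Type*} [Fintype σ] [Nonempty σ] (V : List α) (n : ℕ) :
    expDensity V σ n = (∑ j ∈ Finset.range (n + 1), ∑ i ∈ Finset.range j, instProb V σ (i + 1)) /
      (Nat.choose (n + 1) 2) := by
  classical
  have hq : (0 : ℝ) < Fintype.card σ := by exact_mod_cast Fintype.card_pos
  unfold expDensity density
  simp only [List.length_ofFn]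
  rw [← Finset.sum_div, div_div, mul_comm, ← div_div]
  congr 1
  rw [div_eq_iff (by positivity)]
  have h1 : ∀ w : Fin n → σ, (((Finset.range (n + 1) ×ˢ Finset.range (n + 1)).filter
      (fun p => p.1 < p.2 ∧ IsInstance V (subword (List.ofFn w) p.1 p.2))).card : ℝ) =
      ∑ j ∈ Finset.range (n + 1), ∑ i ∈ Finset.range j,
        if IsInstance V (subword (List.ofFn w) i j) then (1 : ℝ) else 0 := by
    intro w
    rw [Finset.card_filter, Finset.sum_product_right]
    push_cast
    refine Finset.sum_congr rfl fun j hj => ?_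
    rw [Finset.mem_range] at hj
    rw [← Finset.sum_subset (Finset.range_subset_range.2 hj.le)]
    · refine Finset.sum_congr rfl fun i hi => ?_
      rw [Finset.mem_range] at hi
      simp [hi]
    · intro i _ hi
      rw [Finset.mem_range] at hi
      simp [hi]
  simp only [h1]
  rw [Finset.sum_comm, Finset.sum_mul]
  refine Finset.sum_congr rfl fun j hj => ?_
  rw [Finset.mem_range] at hj
  rw [Finset.sum_comm, ← Finset.sum_range_reflect (fun i => instProb V σ (i + 1)), Finset.sum_mul]
  refine Finset.sum_congr rfl fun i hi => ?_
  rw [Finset.mem_range] at hi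
  have h2 : (∑ w : Fin n → σ, if IsInstance V (subword (List.ofFn w) i j) then (1 : ℝ) else 0)
      = (cntW σ n (fun w => IsInstance V (subword w i j)) : ℝ) := by
    unfold cntW
    rw [Finset.card_filter]
    push_cast
    rfl
  rw [h2, cntW_sub V hi (by omega), show j - 1 - i + 1 = j - i by omega, instProb_eq_s11,
    div_mul_eq_mul_div, eq_div_iff (by positivity)]
  push_cast
  rw [mul_assoc, ← pow_add]
  congr 2
  omega

lemma double_cesaro (a : ℕ → ℝ) (L : ℝ) (h : Tendsto a atTop (nhds L)) :
    Tendsto (fun n : ℕ => (∑ j ∈ Finset.range (n + 1), ∑ i ∈ Finset.range j, a (i + 1)) /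
      (Nat.choose (n + 1) 2)) atTop (nhds L) := by
  have h0 : (fun i => a (i + 1) - L) =o[atTop] (fun _ : ℕ => (1 : ℝ)) := by
    rw [isLittleO_one_iff]
    simpa using ((tendsto_add_atTop_iff_nat 1).2 h).sub_const L
  have h1 := h0.sum_range (fun _ => zero_le_one)
    (by simpa using tendsto_natCast_atTop_atTop (R := ℝ))
  have hsum : ∀ n : ℕ, ∑ j ∈ Finset.range n, ((j : ℕ) : ℝ) = (Nat.choose n 2 : ℕ) := by
    intro n
    rw [Nat.choose_two_right, ← Finset.sum_range_id]; push_cast; rfl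
  simp only [Finset.sum_const, Finset.card_range, nsmul_eq_mul, mul_one] at h1
  have htop : Tendsto (fun n : ℕ => ∑ j ∈ Finset.range n, ((j : ℕ) : ℝ)) atTop atTop := by
    rw [← tendsto_add_atTop_iff_nat 1]
    refine tendsto_atTop_mono (fun n => ?_) (tendsto_natCast_atTop_atTop (R := ℝ))
    rw [Finset.sum_range_succ]
    have : 0 ≤ ∑ j ∈ Finset.range n, ((j : ℕ) : ℝ) := by positivity
    linarith
  have h2 := (h1.sum_range (fun n => Nat.cast_nonneg n) htop).tendsto_div_nhds_zero
  rw [← tendsto_add_atTop_iff_nat 1] at h2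
  have h3 := h2.add_const L
  rw [zero_add] at h3
  refine h3.congr' ?_
  filter_upwards [eventually_ge_atTop 1] with n hn
  have hpos : (0 : ℝ) < (Nat.choose (n + 1) 2 : ℕ) := by
    exact_mod_cast Nat.choose_pos (by omega)
  simp only [Finset.sum_sub_distrib, Finset.sum_const, Finset.card_range, nsmul_eq_mul,
    ← Finset.sum_mul, hsum]
  field_simp
  ring

/-- For nondoubled `V` and finite nonempty `Σ`, `lim_n E(δ(V,W_n))` exists and
equals `I(V,Σ) = lim_n I_n(V,Σ)`. -/
theorem stmt11 {α σ : Type*} [DecidableEq α] [Fintype σ] [Nonempty σ] (V : List α)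
    (hV : ∃ a ∈ V, V.count a = 1) :
    ∃ L : ℝ, Tendsto (fun n => instProb V σ n) atTop (nhds L) ∧
      Tendsto (fun n => expDensity V σ n) atTop (nhds L) := by
  obtain ⟨L, hL⟩ := instProb_conv (σ := σ) V hV
  refine ⟨L, hL, ?_⟩
  simp only [expDensity_eq]
  exact double_cesaro _ L hL
end

section
/- Let V be a doubled word, Σ a finite alphabet with q ≥ 2 letters, and W_n ∈ Σ^n chosen uniformly at random. Then for every positive integer p, the p-th raw moment satisfies E(δ(V,W_n)^p) = O((log(n)/n)^p). -/
open Filter Asymptotics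

/-- Decoding of a compressed word: pieces of `u` are glued together. -/
def decodeWord {σ : Type*} (n r N : ℕ)
    (x : ((Fin (n+1) × Fin (n+1)) × (Fin (n+1) × Fin (n+1)) ×
      (Fin r → Fin (n+1) × Fin (n+1))) × (Fin N → σ)) : List σ :=
  ((List.ofFn x.2).drop x.1.1.1).take x.1.1.2 ++
  ((List.ofFn fun k => ((List.ofFn x.2).drop (x.1.2.2 k).1).take (x.1.2.2 k).2).flatten ++
  ((List.ofFn x.2).drop x.1.2.1.1).take x.1.2.1.2)

theorem infix_slice {σ : Type*} (n : ℕ) (l u : List σ) (h : l <:+: u) (hu : u.length ≤ n) :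
    ∃ c : Fin (n+1) × Fin (n+1), (u.drop c.1).take c.2 = l := by
  obtain ⟨s, t, rfl⟩ := h
  simp only [List.length_append] at hu
  refine ⟨(⟨s.length, by omega⟩, ⟨l.length, by omega⟩), ?_⟩
  simp

theorem infix_flat {σ : Type*} (l : List σ) (L : List (List σ)) (h : l ∈ L) :
    l <:+: L.flatten := by
  obtain ⟨s, t, rfl⟩ := List.append_of_mem h
  exact ⟨s.flatten, t.flatten, by simp⟩

theorem doubled_sum {α : Type*} [DecidableEq α] (V : List α) (h : Doubled V) (f : α → ℕ) :
    2 * (V.toFinset.toList.map f).sum ≤ (V.map f).sum := by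
  rw [Finset.sum_map_toList, Finset.sum_list_map_count, Finset.mul_sum]
  refine Finset.sum_le_sum fun a ha => ?_
  have := h a (List.mem_toFinset.1 ha)
  simpa using Nat.mul_le_mul_right _ this

theorem bad_mem {α σ : Type*} [DecidableEq α] [Nonempty σ] (V : List α) (hdbl : Doubled V)
    (n M i j : ℕ) (w : Fin n → σ) (hj : j ≤ n) (hij : i + 2 * M ≤ j)
    (hI : IsInstance V (subword (List.ofFn w) i j)) :
    ∃ x, decodeWord n V.length (n - M) x = List.ofFn w := by
  obtain ⟨φ, -, hφ⟩ := hI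
  set W := List.ofFn w with hW
  have hlen : W.length = n := by simp [hW]
  obtain ⟨e⟩ := ‹Nonempty σ›
  have hsplit : W = W.take i ++ (subword W i j ++ W.drop j) := by
    have h1 : W.drop j = (W.drop i).drop (j - i) := by
      rw [List.drop_drop]; congr 1; omega
    rw [h1, subword, List.take_append_drop, List.take_append_drop]
  have hsub : (V.map (fun a => (φ a).length)).sum = j - i := by
    have := congrArg List.length hφ
    simp only [subword, List.length_take, List.length_drop, List.length_flatten,
      List.map_map, hlen] at this
    have h2 : (V.map (fun a => (φ a).length)) = (V.map (List.length ∘ φ)) := rfl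
    rw [h2]; omega
  have hd := doubled_sum V hdbl (fun a => (φ a).length)
  set P := (V.toFinset.toList.map φ).flatten with hP
  have hPl : P.length = (V.toFinset.toList.map (fun a => (φ a).length)).sum := by
    simp [hP, List.length_flatten, Function.comp_def]
  set u0 := W.take i ++ (P ++ W.drop j) with hu0
  have hu0l : u0.length ≤ n - M := by
    simp only [hu0, List.length_append, List.length_take, List.length_drop, hlen]
    omega
  set u := u0 ++ List.replicate (n - M - u0.length) e with hu
  have hul : u.length = n - M := by
    simp [hu]; omega
  have huF : List.ofFn (fun k : Fin (n - M) => u.get (k.cast hul.symm)) = u := by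
    apply List.ext_get
    · simp [hul]
    · intro k h1 h2; simp
  have hun : u.length ≤ n := by omega
  have key : ∀ l : List σ, l <:+: u0 → ∃ c : Fin (n+1) × Fin (n+1), (u.drop c.1).take c.2 = l := by
    intro l hl
    exact infix_slice n l u (hl.trans (List.prefix_append _ _).isInfix) hun
  obtain ⟨cA, hA⟩ := key (W.take i) (List.prefix_append _ _).isInfix
  obtain ⟨cB, hB⟩ := key (W.drop j) (by
    rw [hu0, ← List.append_assoc]; exact (List.suffix_append _ _).isInfix)
  have hV : ∀ k : Fin V.length, ∃ c : Fin (n+1) × Fin (n+1),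
      (u.drop c.1).take c.2 = φ (V.get k) := by
    intro k
    apply key
    have h1 : φ (V.get k) <:+: P := by
      apply infix_flat
      apply List.mem_map_of_mem
      simp
    exact h1.trans ⟨W.take i, W.drop j, by simp [hu0]⟩
  choose c hc using hV
  refine ⟨((cA, cB, c), fun k : Fin (n - M) => u.get (k.cast hul.symm)), ?_⟩
  unfold decodeWord
  simp only [huF, hA, hB, hc]
  conv_rhs => rw [hsplit, hφ]
  congr 3
  apply List.ext_get
  · simp
  · intro k h1 h2; simp

open Classical in
theorem bad_card_s16 {α σ : Type*} [DecidableEq α] [Fintype σ] [Nonempty σ] (V : List α)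
    (hdbl : Doubled V) (n M : ℕ) :
    (Finset.univ.filter (fun w : Fin n → σ => ∃ i j, j ≤ n ∧ i + 2 * M < j ∧
      IsInstance V (subword (List.ofFn w) i j))).card * Fintype.card σ ^ M ≤
    (n + 1) ^ (2 * (V.length + 2)) * Fintype.card σ ^ n := by
  set B := Finset.univ.filter (fun w : Fin n → σ => ∃ i j, j ≤ n ∧ i + 2 * M < j ∧
      IsInstance V (subword (List.ofFn w) i j)) with hB
  rcases Nat.lt_or_ge n M with h | h
  · have : B = ∅ := by
      apply Finset.filter_eq_empty_iff.2
      rintro w - ⟨i, j, h1, h2, -⟩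
      omega
    simp [this]
  · have h1 : B.card ≤ (n + 1) ^ (2 * (V.length + 2)) * Fintype.card σ ^ (n - M) := by
      calc B.card = (B.image List.ofFn).card :=
            (Finset.card_image_of_injective _ List.ofFn_injective).symm
        _ ≤ (Finset.univ.image (decodeWord (σ := σ) n V.length (n - M))).card := by
            apply Finset.card_le_card
            intro l hl
            obtain ⟨w, hw, rfl⟩ := Finset.mem_image.1 hl
            obtain ⟨i, j, h1, h2, h3⟩ := (Finset.mem_filter.1 hw).2
            obtain ⟨x, hx⟩ := bad_mem V hdbl n M i j w h1 h2.le h3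
            exact Finset.mem_image.2 ⟨x, Finset.mem_univ _, hx⟩
        _ ≤ _ := Finset.card_image_le
        _ = _ := by
            simp [Finset.card_univ]
            generalize n + 1 = y
            ring
    calc B.card * Fintype.card σ ^ M
        ≤ (n + 1) ^ (2 * (V.length + 2)) * Fintype.card σ ^ (n - M) * Fintype.card σ ^ M :=
          Nat.mul_le_mul_right _ h1
      _ = _ := by rw [mul_assoc, ← pow_add, Nat.sub_add_cancel h]

theorem choose_cast (n : ℕ) : ((Nat.choose (n + 1) 2 : ℕ) : ℝ) = (n + 1) * n / 2 := by
  rw [Nat.cast_choose_two]; push_cast; ring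

theorem density_le_four {α β : Type*} (V : List α) (W : List β) (h : 1 ≤ W.length) :
    density V W ≤ 4 := by
  classical
  unfold density
  have h' : (1 : ℝ) ≤ W.length := by exact_mod_cast h
  rw [choose_cast, div_le_iff₀ (by positivity)]
  have := Finset.card_filter_le (Finset.range (W.length + 1) ×ˢ Finset.range (W.length + 1))
    (fun p => p.1 < p.2 ∧ IsInstance V (subword W p.1 p.2))
  rw [Finset.card_product, Finset.card_range] at this
  have h2 := (Nat.cast_le (α := ℝ)).2 this
  push_cast at h2
  refine le_trans (le_of_eq_of_le ?_ h2) ?_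
  · congr!
  · nlinarith

theorem density_le_short {α β : Type*} (V : List α) (W : List β) (M : ℕ) (h : 1 ≤ W.length)
    (hg : ¬ ∃ i j, j ≤ W.length ∧ i + 2 * M < j ∧ IsInstance V (subword W i j)) :
    density V W ≤ 4 * M / W.length := by
  classical
  unfold density
  have h' : (1 : ℝ) ≤ W.length := by exact_mod_cast h
  rw [choose_cast, div_le_div_iff₀ (by positivity) (by positivity)]
  have : ((Finset.range (W.length + 1) ×ˢ Finset.range (W.length + 1)).filter
    (fun p => p.1 < p.2 ∧ IsInstance V (subword W p.1 p.2))).card ≤ (W.length + 1) * (2 * M) := by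
    calc _ ≤ ((Finset.range (W.length + 1) ×ˢ Finset.range (2 * M)).image
              (fun p => (p.1, p.1 + p.2 + 1))).card := by
            apply Finset.card_le_card
            rintro ⟨i, j⟩ hp
            simp only [Finset.mem_filter, Finset.mem_product, Finset.mem_range] at hp
            have : ¬ (i + 2 * M < j) := fun hh => hg ⟨i, j, by omega, hh, hp.2.2⟩
            refine Finset.mem_image.2 ⟨(i, j - i - 1), ?_, ?_⟩
            · simp only [Finset.mem_product, Finset.mem_range]; omega
            · simp only [Prod.mk.injEq, true_and]; omega
      _ ≤ _ := Finset.card_image_le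
      _ = _ := by simp
  have h2 := (Nat.cast_le (α := ℝ)).2 this
  push_cast at h2
  have h3 := mul_le_mul_of_nonneg_right h2 (by positivity : (0:ℝ) ≤ W.length)
  refine le_trans (le_of_eq_of_le ?_ h3) (le_of_eq ?_)
  · congr!
  · ring

/-- For a doubled word `V`, `|Σ| = q ≥ 2`, and any positive integer `p`, the
`p`-th raw moment satisfies `E(δ(V,W_n)^p) = O((log n / n)^p)`. -/
theorem stmt16 {α σ : Type*} [DecidableEq α] [Fintype σ] (V : List α)
    (hdbl : Doubled V) (hq : 2 ≤ Fintype.card σ) (p : ℕ) (hp : 0 < p) :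
    (fun n : ℕ =>
        (∑ w : Fin n → σ, (density V (List.ofFn w)) ^ p) / (Fintype.card σ : ℝ) ^ n)
      =O[atTop] (fun n : ℕ => (Real.log n / n) ^ p) := by
  classical
  have hne : Nonempty σ := Fintype.card_pos_iff.1 (by omega)
  set d := 2 * (V.length + 2) with hd
  set c := d + p with hc
  apply IsBigO.of_bound ((12 * (c : ℝ)) ^ p + 4 ^ p)
  filter_upwards [eventually_ge_atTop 3] with n hn
  have hn0 : (0 : ℝ) < n := by exact_mod_cast (by omega : 0 < n)
  have hn3 : (3 : ℝ) ≤ n := by exact_mod_cast hn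
  have hlog : 1 ≤ Real.log n := by
    rw [Real.le_log_iff_exp_le hn0]
    have := Real.exp_one_lt_d9
    linarith
  have hqn : (0 : ℝ) < (Fintype.card σ : ℝ) ^ n := by
    have : (0 : ℝ) < Fintype.card σ := by exact_mod_cast (by omega : 0 < Fintype.card σ)
    positivity
  have hdn : ∀ w : Fin n → σ, 0 ≤ density V (List.ofFn w) := fun w => by
    unfold density; positivity
  rw [Real.norm_of_nonneg (div_nonneg (Finset.sum_nonneg fun w _ => pow_nonneg (hdn w) p) hqn.le),
    Real.norm_of_nonneg (by positivity)]
  set M := c * (Nat.log 2 n + 1) with hM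
  set B := Finset.univ.filter (fun w : Fin n → σ => ∃ i j, j ≤ n ∧ i + 2 * M < j ∧
      IsInstance V (subword (List.ofFn w) i j)) with hB
  have hMlog : 4 * (M : ℝ) ≤ 12 * c * Real.log n := by
    have h1 : ((Nat.log 2 n : ℕ) : ℝ) ≤ Real.logb 2 n := by
      exact_mod_cast Real.natLog_le_logb n 2
    have h2 : Real.logb 2 n ≤ 2 * Real.log n := by
      rw [Real.logb, div_le_iff₀ (Real.log_pos (by norm_num))]
      have := Real.log_two_gt_d9
      nlinarith
    have h3 : (Nat.log 2 n : ℝ) + 1 ≤ 3 * Real.log n := by linarith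
    have h4 := mul_le_mul_of_nonneg_left h3 (by positivity : (0 : ℝ) ≤ 4 * c)
    rw [hM]; push_cast; linarith
  have hpt : ∀ w : Fin n → σ, density V (List.ofFn w) ^ p ≤
      (12 * c * (Real.log n / n)) ^ p + if w ∈ B then 4 ^ p else 0 := by
    intro w
    split_ifs with hw
    · have := pow_le_pow_left₀ (hdn w)
        (density_le_four V (List.ofFn w) (by rw [List.length_ofFn]; omega)) p
      have h0 : (0 : ℝ) ≤ (12 * c * (Real.log n / n)) ^ p := by positivity
      linarith
    · rw [add_zero]
      apply pow_le_pow_left₀ (hdn w)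
      have h1 := density_le_short V (List.ofFn w) M (by rw [List.length_ofFn]; omega) (by
        rw [List.length_ofFn]
        intro hh
        exact hw (Finset.mem_filter.2 ⟨Finset.mem_univ _, hh⟩))
      rw [List.length_ofFn] at h1
      refine h1.trans ?_
      rw [← mul_div_assoc]
      gcongr
  have hBc : (B.card : ℝ) * n ^ p ≤ (Fintype.card σ : ℝ) ^ n := by
    have h1 : B.card * Fintype.card σ ^ M ≤ (n + 1) ^ d * Fintype.card σ ^ n :=
      bad_card_s16 V hdbl n M
    have h2 : (n + 1) ^ c ≤ Fintype.card σ ^ M := by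
      calc (n + 1) ^ c ≤ (2 ^ (Nat.log 2 n + 1)) ^ c :=
            Nat.pow_le_pow_left (Nat.lt_pow_succ_log_self (by norm_num) n) c
        _ = 2 ^ M := by rw [hM, ← pow_mul, mul_comm]
        _ ≤ _ := Nat.pow_le_pow_left hq M
    have h3 : (n + 1) ^ d * (B.card * (n + 1) ^ p) ≤ (n + 1) ^ d * Fintype.card σ ^ n := by
      calc (n + 1) ^ d * (B.card * (n + 1) ^ p) = B.card * (n + 1) ^ c := by
            rw [hc, pow_add]; ring
        _ ≤ B.card * Fintype.card σ ^ M := Nat.mul_le_mul_left _ h2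
        _ ≤ _ := h1
    have h4 := Nat.le_of_mul_le_mul_left h3 (by positivity)
    have h5 : B.card * n ^ p ≤ Fintype.card σ ^ n :=
      (Nat.mul_le_mul_left _ (Nat.pow_le_pow_left (Nat.le_succ n) p)).trans h4
    exact_mod_cast h5
  rw [div_le_iff₀ hqn]
  calc ∑ w : Fin n → σ, density V (List.ofFn w) ^ p
      ≤ ∑ w : Fin n → σ, ((12 * c * (Real.log n / n)) ^ p + if w ∈ B then 4 ^ p else 0) :=
        Finset.sum_le_sum fun w _ => hpt w
    _ = (Fintype.card σ : ℝ) ^ n * (12 * c * (Real.log n / n)) ^ p + B.card * 4 ^ p := by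
        rw [Finset.sum_add_distrib, Finset.sum_ite_mem]
        simp
    _ ≤ (Fintype.card σ : ℝ) ^ n * (12 * c * (Real.log n / n)) ^ p +
        4 ^ p * (Real.log n / n) ^ p * (Fintype.card σ : ℝ) ^ n := by
        have h6 : (B.card : ℝ) ≤ (Real.log n / n) ^ p * (Fintype.card σ : ℝ) ^ n := by
          rw [div_pow, div_mul_eq_mul_div, le_div_iff₀ (by positivity)]
          have h7 : (1 : ℝ) ≤ Real.log n ^ p := one_le_pow₀ hlog
          nlinarith
        have h8 := mul_le_mul_of_nonneg_left h6 (by positivity : (0 : ℝ) ≤ 4 ^ p)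
        linarith
    _ = _ := by rw [mul_pow]; ring
end
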